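/- arXiv:1412.1537 — 2 statements merged into one kernel-verified Lean document; each statement's English description precedes it below -/
import Mathlib

section
/- Let n ≥ 2. There exists a constant B > 0, depending only on n, with the following property. Let β > 0 and 0 < p < β. Suppose φ ∈ C²(D) and 𝒱 ∈ C⁰(D) satisfy |□φ| ≤ |𝒱|·|φ| everywhere on D, that φ satisfies the decay condition Dec(β), and that |𝒱| ≤ B·p·min(β−p, p)·min(|uv|^{−1+p/2}, |uv|^{−1−p/2}) everywhere on D. Then φ = 0 everywhere on D. -/
open Real MeasureTheory
open scoped BigOperators

noncomputable section

/-- Minkowski spacetime `ℝ^{1+n}`, with coordinates `(t, x)`. -/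
abbrev Spacetime (n : ℕ) := ℝ × EuclideanSpace ℝ (Fin n)

/-- The exterior `D` of the light cone: `{(t,x) : |t| < |x|}`. -/
def Dom (n : ℕ) : Set (Spacetime n) := {p | |p.1| < ‖p.2‖}

/-- Partial derivative in the time direction. -/
def dt {n : ℕ} (φ : Spacetime n → ℝ) (p : Spacetime n) : ℝ :=
  fderiv ℝ φ p (1, 0)

/-- Partial derivative in the `i`-th spatial direction. -/
def dx {n : ℕ} (i : Fin n) (φ : Spacetime n → ℝ) (p : Spacetime n) : ℝ :=
  fderiv ℝ φ p (0, EuclideanSpace.single i 1)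

/-- The wave operator `□φ = −∂²_t φ + Δ_x φ`. -/
def box {n : ℕ} (φ : Spacetime n → ℝ) (p : Spacetime n) : ℝ :=
  - dt (dt φ) p + ∑ i, dx i (dx i φ) p

/-- Null coordinate `u = (t − r)/2`. -/
def uu {n : ℕ} (p : Spacetime n) : ℝ := (p.1 - ‖p.2‖) / 2

/-- Null coordinate `v = (t + r)/2`. -/
def vv {n : ℕ} (p : Spacetime n) : ℝ := (p.1 + ‖p.2‖) / 2

/-- Radial derivative `∂_r φ = (x/|x|)·∇_x φ`. -/
def dr {n : ℕ} (φ : Spacetime n → ℝ) (p : Spacetime n) : ℝ :=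
  (∑ i, p.2 i * dx i φ p) / ‖p.2‖

/-- `∂_u φ := ∂_t φ − ∂_r φ`. -/
def du {n : ℕ} (φ : Spacetime n → ℝ) (p : Spacetime n) : ℝ := dt φ p - dr φ p

/-- `∂_v φ := ∂_t φ + ∂_r φ`. -/
def dv {n : ℕ} (φ : Spacetime n → ℝ) (p : Spacetime n) : ℝ := dt φ p + dr φ p

/-- The squared angular gradient `|∇̸φ|² = |∇_x φ|² − (∂_r φ)²`. -/
def angSq {n : ℕ} (φ : Spacetime n → ℝ) (p : Spacetime n) : ℝ :=
  (∑ i, (dx i φ p) ^ 2) - (dr φ p) ^ 2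

/-- The decay condition `Dec(γ)` on `D`. -/
def Dec {n : ℕ} (γ : ℝ) (φ : Spacetime n → ℝ) : Prop :=
  (∃ C : ℝ, ∀ p ∈ Dom n,
    ((1 + |uu p|) * (1 + |vv p|)) ^ (((n : ℝ) - 1 + γ) / 2) *
      (|uu p * du φ p| + |vv p * dv φ p|) ≤ C) ∧
  (∃ C : ℝ, ∀ p ∈ Dom n, |uu p * vv p| < 1 →
    ((1 + |uu p|) * (1 + |vv p|)) ^ (((n : ℝ) - 1 + γ) / 2) *
      |uu p * vv p| ^ ((1 : ℝ) / 2) * Real.sqrt (angSq φ p) ≤ C) ∧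
  (∃ C : ℝ, ∀ p ∈ Dom n,
    ((1 + |uu p|) * (1 + |vv p|)) ^ (((n : ℝ) - 1 + γ) / 2) * |φ p| ≤ C)


/-! ### Index-free coordinate calculus -/

/-- Coordinate direction vectors. -/
def ev {n : ℕ} : Option (Fin n) → Spacetime n
  | none => (1, 0)
  | some i => (0, EuclideanSpace.single i 1)

/-- Coordinates. -/
def co {n : ℕ} : Option (Fin n) → Spacetime n → ℝ
  | none => fun q => q.1
  | some i => fun q => q.2 i

/-- Signature. -/
def et {n : ℕ} : Option (Fin n) → ℝ
  | none => -1
  | some _ => 1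

/-- Partial derivatives. -/
def pd {n : ℕ} (m : Option (Fin n)) (f : Spacetime n → ℝ) (q : Spacetime n) : ℝ :=
  fderiv ℝ f q (ev m)

theorem box_eq {n : ℕ} (φ : Spacetime n → ℝ) (q : Spacetime n) :
    box φ q = ∑ m, et m * pd m (pd m φ) q := by
  rw [Fintype.sum_option]
  simp only [box, et]
  have h1 : pd none φ = dt φ := rfl
  have h2 : ∀ i, pd (some i) φ = dx i φ := fun i => rfl
  have h3 : pd none (dt φ) q = dt (dt φ) q := rfl
  have h4 : ∀ i, pd (some i) (dx i φ) q = dx i (dx i φ) q := fun i => rfl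
  simp only [h1, h2, h3, h4]
  simp

theorem pd_add {n : ℕ} (m : Option (Fin n)) {f g : Spacetime n → ℝ} {q : Spacetime n}
    (hf : DifferentiableAt ℝ f q) (hg : DifferentiableAt ℝ g q) :
    pd m (fun x => f x + g x) q = pd m f q + pd m g q := by
  unfold pd
  rw [fderiv_fun_add hf hg]; rfl

theorem pd_sub {n : ℕ} (m : Option (Fin n)) {f g : Spacetime n → ℝ} {q : Spacetime n}
    (hf : DifferentiableAt ℝ f q) (hg : DifferentiableAt ℝ g q) :
    pd m (fun x => f x - g x) q = pd m f q - pd m g q := by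
  unfold pd
  rw [fderiv_fun_sub hf hg]; rfl

theorem pd_mul {n : ℕ} (m : Option (Fin n)) {f g : Spacetime n → ℝ} {q : Spacetime n}
    (hf : DifferentiableAt ℝ f q) (hg : DifferentiableAt ℝ g q) :
    pd m (fun x => f x * g x) q = pd m f q * g q + f q * pd m g q := by
  unfold pd
  rw [fderiv_fun_mul hf hg]
  simp only [add_apply, smul_apply, smul_eq_mul]
  ring

theorem pd_const {n : ℕ} (m : Option (Fin n)) (c : ℝ) (q : Spacetime n) :
    pd m (fun _ => c) q = 0 := by
  unfold pd
  simp

theorem pd_sum {n : ℕ} (m : Option (Fin n)) {ι : Type*} [Fintype ι] {f : ι → Spacetime n → ℝ}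
    {q : Spacetime n} (hf : ∀ i, DifferentiableAt ℝ (f i) q) :
    pd m (fun x => ∑ i, f i x) q = ∑ i, pd m (f i) q := by
  unfold pd
  rw [fderiv_fun_sum (fun i _ => hf i)]
  simp

theorem pd_comp {n : ℕ} (m : Option (Fin n)) {F : ℝ → ℝ} {F' : ℝ} {f : Spacetime n → ℝ}
    {q : Spacetime n} (hF : HasDerivAt F F' (f q)) (hf : DifferentiableAt ℝ f q) :
    pd m (fun x => F (f x)) q = F' * pd m f q := by
  unfold pd
  have := (hF.comp_hasFDerivAt q hf.hasFDerivAt).fderiv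
  have h2 : (fun x => F (f x)) = F ∘ f := rfl
  rw [h2, this]
  simp

theorem pd_congr {n : ℕ} (m : Option (Fin n)) {f g : Spacetime n → ℝ} {q : Spacetime n}
    (h : f =ᶠ[nhds q] g) : pd m f q = pd m g q := by
  unfold pd
  rw [h.fderiv_eq]

theorem contDiff_co {n : ℕ} (m : Option (Fin n)) {k : WithTop ℕ∞} : ContDiff ℝ k (co m) := by
  cases m with
  | none => exact contDiff_fst
  | some i =>
    have : ContDiff ℝ k (fun q : Spacetime n => q.2 i) := by fun_prop
    exact this

theorem diff_co {n : ℕ} (m : Option (Fin n)) (q : Spacetime n) :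
    DifferentiableAt ℝ (co m) q :=
  (contDiff_co (k := 1) m).differentiable (by simp) q

theorem pd_co {n : ℕ} (m l : Option (Fin n)) (q : Spacetime n) :
    pd m (co l) q = if l = m then 1 else 0 := by
  unfold pd
  cases l with
  | none =>
    have h : HasFDerivAt (co none : Spacetime n → ℝ)
      (ContinuousLinearMap.fst ℝ ℝ (EuclideanSpace ℝ (Fin n))) q := hasFDerivAt_fst
    rw [h.fderiv]
    cases m <;> simp [ev]
  | some i =>
    have h : HasFDerivAt (co (some i) : Spacetime n → ℝ)
      ((EuclideanSpace.proj i).comp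
        (ContinuousLinearMap.snd ℝ ℝ (EuclideanSpace ℝ (Fin n)))) q :=
      ((EuclideanSpace.proj (𝕜 := ℝ) i).comp
        (ContinuousLinearMap.snd ℝ ℝ (EuclideanSpace ℝ (Fin n)))).hasFDerivAt
    rw [h.fderiv]
    cases m <;> simp [ev]

theorem contDiffAt_pd {n : ℕ} {φ : Spacetime n → ℝ} {q : Spacetime n}
    (h : ContDiffAt ℝ 2 φ q) (m : Option (Fin n)) : ContDiffAt ℝ 1 (pd m φ) q := by
  have h1 : ContDiffAt ℝ 1 (fderiv ℝ φ) q := h.fderiv_right (by norm_num)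
  exact h1.clm_apply contDiffAt_const

theorem pd_symm {n : ℕ} {φ : Spacetime n → ℝ} {q : Spacetime n}
    (h : ContDiffAt ℝ 2 φ q) (m l : Option (Fin n)) :
    pd m (pd l φ) q = pd l (pd m φ) q := by
  have h1 : DifferentiableAt ℝ (fderiv ℝ φ) q :=
    (h.fderiv_right (m := 1) (by norm_num)).differentiableAt (by simp)
  have hs : IsSymmSndFDerivAt ℝ φ q := h.isSymmSndFDerivAt (by simp)
  have key : ∀ a b : Option (Fin n), pd a (pd b φ) q = fderiv ℝ (fderiv ℝ φ) q (ev a) (ev b) := by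
    intro a b
    have : pd b φ = fun x => fderiv ℝ φ x (ev b) := rfl
    rw [this]
    unfold pd
    rw [fderiv_clm_apply h1 (differentiableAt_const _)]
    simp
  rw [key, key]
  exact hs (ev m) (ev l)

/-- Scaling derivative. -/
def Sf {n : ℕ} (φ : Spacetime n → ℝ) (q : Spacetime n) : ℝ := ∑ l, co l q * pd l φ q

/-- Minkowski square of the gradient. -/
def Qf {n : ℕ} (φ : Spacetime n → ℝ) (q : Spacetime n) : ℝ := ∑ l, et l * (pd l φ q * pd l φ q)

/-- Minkowski product of gradients. -/
def mf {n : ℕ} (f φ : Spacetime n → ℝ) (q : Spacetime n) : ℝ := ∑ l, et l * (pd l f q * pd l φ q)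

/-- The current. -/
def Jf {n : ℕ} (a g e φ : Spacetime n → ℝ) (m : Option (Fin n)) (q : Spacetime n) : ℝ :=
  a q * (Sf φ q + g q * φ q) * (et m * pd m φ q)
    + (e q * (φ q * φ q) - 1 / 2 * (a q * Qf φ q)) * co m q

theorem contDiffAt_Sf {n : ℕ} {φ : Spacetime n → ℝ} {q : Spacetime n}
    (h : ContDiffAt ℝ 2 φ q) : ContDiffAt ℝ 1 (Sf φ) q := by
  unfold Sf
  exact ContDiffAt.sum fun l _ => (contDiff_co l).contDiffAt.mul (contDiffAt_pd h l)

theorem contDiffAt_Qf {n : ℕ} {φ : Spacetime n → ℝ} {q : Spacetime n}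
    (h : ContDiffAt ℝ 2 φ q) : ContDiffAt ℝ 1 (Qf φ) q := by
  unfold Qf
  exact ContDiffAt.sum fun l _ =>
    contDiffAt_const.mul ((contDiffAt_pd h l).mul (contDiffAt_pd h l))

theorem contDiffAt_Jf {n : ℕ} {a g e φ : Spacetime n → ℝ} {q : Spacetime n}
    (h : ContDiffAt ℝ 2 φ q) (ha : ContDiffAt ℝ 1 a q) (hg : ContDiffAt ℝ 1 g q)
    (he : ContDiffAt ℝ 1 e q) (m : Option (Fin n)) : ContDiffAt ℝ 1 (Jf a g e φ m) q := by
  unfold Jf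
  have h1 : ContDiffAt ℝ 1 φ q := h.of_le (by norm_num)
  have h2 := contDiffAt_Sf h
  have h3 := contDiffAt_Qf h
  have h4 := contDiffAt_pd h m
  have h5 : ContDiffAt ℝ 1 (co m) q := (contDiff_co m).contDiffAt
  fun_prop

theorem pd_Sf {n : ℕ} {φ : Spacetime n → ℝ} {q : Spacetime n}
    (h : ContDiffAt ℝ 2 φ q) (m : Option (Fin n)) :
    pd m (Sf φ) q = pd m φ q + ∑ l, co l q * pd m (pd l φ) q := by
  have hd : ∀ l, DifferentiableAt ℝ (pd l φ) q := fun l =>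
    (contDiffAt_pd h l).differentiableAt (by simp)
  have : Sf φ = fun x => ∑ l, co l x * pd l φ x := rfl
  rw [this, pd_sum m (fun l => (diff_co l q).fun_mul (hd l))]
  have : ∀ l, pd m (fun x => co l x * pd l φ x) q
      = (if l = m then pd l φ q else 0) + co l q * pd m (pd l φ) q := by
    intro l
    rw [pd_mul m (diff_co l q) (hd l), pd_co]
    split_ifs <;> simp
  simp only [this, Finset.sum_add_distrib]
  simp

theorem pd_Qf {n : ℕ} {φ : Spacetime n → ℝ} {q : Spacetime n}
    (h : ContDiffAt ℝ 2 φ q) (m : Option (Fin n)) :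
    pd m (Qf φ) q = 2 * ∑ l, et l * pd l φ q * pd m (pd l φ) q := by
  have hd : ∀ l, DifferentiableAt ℝ (pd l φ) q := fun l =>
    (contDiffAt_pd h l).differentiableAt (by simp)
  have : Qf φ = fun x => ∑ l, et l * (pd l φ x * pd l φ x) := rfl
  rw [this, pd_sum m (fun l => (differentiableAt_const _).fun_mul ((hd l).fun_mul (hd l)))]
  rw [Finset.mul_sum]
  refine Finset.sum_congr rfl fun l _ => ?_
  rw [pd_mul m (differentiableAt_const _) ((hd l).fun_mul (hd l)), pd_mul m (hd l) (hd l), pd_const]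
  ring

theorem div_Jf {n : ℕ} {a g e φ : Spacetime n → ℝ} {q : Spacetime n}
    (h : ContDiffAt ℝ 2 φ q) (ha : DifferentiableAt ℝ a q) (hg : DifferentiableAt ℝ g q)
    (he : DifferentiableAt ℝ e q) :
    ∑ m, pd m (Jf a g e φ m) q =
      (Sf φ q + g q * φ q) * mf a φ q + a q * Qf φ q + a q * φ q * mf g φ q
      + a q * g q * Qf φ q + a q * (Sf φ q + g q * φ q) * box φ q
      + φ q * φ q * Sf e q + 2 * e q * φ q * Sf φ q - 1 / 2 * Qf φ q * Sf a q
      + ((n : ℝ) + 1) * (e q * (φ q * φ q) - 1 / 2 * (a q * Qf φ q)) := by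
  have hφ : DifferentiableAt ℝ φ q := h.differentiableAt (by simp)
  have hS : DifferentiableAt ℝ (Sf φ) q := (contDiffAt_Sf h).differentiableAt (by simp)
  have hQ : DifferentiableAt ℝ (Qf φ) q := (contDiffAt_Qf h).differentiableAt (by simp)
  have hd : ∀ l, DifferentiableAt ℝ (pd l φ) q := fun l =>
    (contDiffAt_pd h l).differentiableAt (by simp)
  have hc : ∀ c : ℝ, DifferentiableAt ℝ (fun _ : Spacetime n => c) q :=
    fun c => differentiableAt_const c
  have term : ∀ m, pd m (Jf a g e φ m) q =
      (Sf φ q + g q * φ q) * (et m * (pd m a q * pd m φ q))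
      + a q * (et m * (pd m φ q * pd m φ q))
      + a q * ∑ l, co l q * (et m * pd m φ q * pd m (pd l φ) q)
      + a q * φ q * (et m * (pd m g q * pd m φ q))
      + a q * g q * (et m * (pd m φ q * pd m φ q))
      + a q * (Sf φ q + g q * φ q) * (et m * pd m (pd m φ) q)
      + φ q * φ q * (co m q * pd m e q)
      + 2 * e q * φ q * (co m q * pd m φ q)
      - 1 / 2 * Qf φ q * (co m q * pd m a q)
      - a q * ∑ l, co m q * (et l * pd l φ q * pd l (pd m φ) q)
      + (e q * (φ q * φ q) - 1 / 2 * (a q * Qf φ q)) := by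
    intro m
    have e1 : pd m (Jf a g e φ m) q = pd m (fun x => a x * (Sf φ x + g x * φ x) * (et m * pd m φ x)
      + (e x * (φ x * φ x) - 1 / 2 * (a x * Qf φ x)) * co m x) q := rfl
    rw [e1, pd_add m
        ((ha.fun_mul (hS.fun_add (hg.fun_mul hφ))).fun_mul ((hc _).fun_mul (hd m)))
        (((he.fun_mul (hφ.fun_mul hφ)).fun_sub ((hc _).fun_mul (ha.fun_mul hQ))).fun_mul (diff_co m q)),
      pd_mul m (ha.fun_mul (hS.fun_add (hg.fun_mul hφ))) ((hc _).fun_mul (hd m)),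
      pd_mul m ha (hS.fun_add (hg.fun_mul hφ)), pd_add m hS (hg.fun_mul hφ), pd_mul m hg hφ,
      pd_mul m (hc _) (hd m),
      pd_mul m ((he.fun_mul (hφ.fun_mul hφ)).fun_sub ((hc _).fun_mul (ha.fun_mul hQ))) (diff_co m q),
      pd_sub m (he.fun_mul (hφ.fun_mul hφ)) ((hc _).fun_mul (ha.fun_mul hQ)),
      pd_mul m he (hφ.fun_mul hφ), pd_mul m hφ hφ, pd_mul m (hc _) (ha.fun_mul hQ), pd_mul m ha hQ,
      pd_const, pd_const, pd_co, pd_Sf h, pd_Qf h]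
    have e2 : ∑ l, co l q * (et m * pd m φ q * pd m (pd l φ) q)
        = et m * pd m φ q * ∑ l, co l q * pd m (pd l φ) q := by
      rw [Finset.mul_sum]; exact Finset.sum_congr rfl fun l _ => by ring
    have e3 : ∑ l, co m q * (et l * pd l φ q * pd l (pd m φ) q)
        = co m q * ∑ l, et l * pd l φ q * pd m (pd l φ) q := by
      rw [Finset.mul_sum]
      exact Finset.sum_congr rfl fun l _ => by rw [pd_symm h l m]
    rw [e2, e3]
    simp only [if_true]
    ring
  simp only [term, Finset.sum_add_distrib, Finset.sum_sub_distrib, ← Finset.mul_sum]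
  have sw : ∑ m, ∑ l, co l q * (et m * pd m φ q * pd m (pd l φ) q)
      = ∑ m, ∑ l, co m q * (et l * pd l φ q * pd l (pd m φ) q) := Finset.sum_comm
  simp only [← Finset.mul_sum] at sw
  rw [sw, box_eq]
  simp only [Sf, Qf, mf, Finset.sum_const, Finset.card_univ, Fintype.card_option, Fintype.card_fin,
    nsmul_eq_mul]
  push_cast
  ring

/-! ### Geometry of the exterior domain -/

/-- `s = (1/2) log |uv|`. -/
def ls {n : ℕ} (q : Spacetime n) : ℝ := (Real.log (vv q) + Real.log (-uu q)) / 2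

/-- `τ = (1/2) log |v/u|`. -/
def lt {n : ℕ} (q : Spacetime n) : ℝ := (Real.log (vv q) - Real.log (-uu q)) / 2

/-- `r² - t²`. -/
def yy {n : ℕ} (q : Spacetime n) : ℝ := ‖q.2‖ ^ 2 - q.1 ^ 2

/-- Boost derivative. -/
def Tf {n : ℕ} (φ : Spacetime n → ℝ) (q : Spacetime n) : ℝ := ‖q.2‖ * dt φ q + q.1 * dr φ q

theorem isOpen_Dom (n : ℕ) : IsOpen (Dom n) :=
  isOpen_lt (by fun_prop) (by fun_prop)

theorem vv_pos {n : ℕ} {q : Spacetime n} (hq : q ∈ Dom n) : 0 < vv q := by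
  have h : |q.1| < ‖q.2‖ := hq
  have := (abs_lt.1 h).1
  unfold vv; linarith

theorem uu_neg {n : ℕ} {q : Spacetime n} (hq : q ∈ Dom n) : 0 < -uu q := by
  have h : |q.1| < ‖q.2‖ := hq
  have := (abs_lt.1 h).2
  unfold uu; linarith

theorem norm_pos_Dom {n : ℕ} {q : Spacetime n} (hq : q ∈ Dom n) : 0 < ‖q.2‖ :=
  lt_of_le_of_lt (abs_nonneg q.1) hq

theorem yy_eq {n : ℕ} (q : Spacetime n) : yy q = 4 * (vv q * -uu q) := by
  unfold yy vv uu; ring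

theorem yy_pos {n : ℕ} {q : Spacetime n} (hq : q ∈ Dom n) : 0 < yy q := by
  rw [yy_eq]; have := vv_pos hq; have := uu_neg hq; positivity

theorem exp_ls {n : ℕ} {q : Spacetime n} (hq : q ∈ Dom n) :
    Real.exp (2 * ls q) = vv q * -uu q := by
  have h : 2 * ls q = Real.log (vv q) + Real.log (-uu q) := by unfold ls; ring
  rw [h, Real.exp_add, Real.exp_log (vv_pos hq), Real.exp_log (uu_neg hq)]

theorem yy_exp {n : ℕ} {q : Spacetime n} (hq : q ∈ Dom n) :
    yy q = 4 * Real.exp (2 * ls q) := by rw [exp_ls hq, yy_eq]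

theorem abs_uv {n : ℕ} {q : Spacetime n} (hq : q ∈ Dom n) :
    |uu q * vv q| = Real.exp (2 * ls q) := by
  rw [exp_ls hq]
  have : uu q * vv q = -(vv q * -uu q) := by ring
  rw [this, abs_neg, abs_of_pos (mul_pos (vv_pos hq) (uu_neg hq))]

theorem contDiffAt_r {n : ℕ} {q : Spacetime n} (hq : q ∈ Dom n) {k : WithTop ℕ∞} :
    ContDiffAt ℝ k (fun q : Spacetime n => ‖q.2‖) q :=
  ContDiffAt.norm ℝ contDiffAt_snd (norm_pos_iff.1 (norm_pos_Dom hq))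

theorem contDiffAt_vv {n : ℕ} {q : Spacetime n} (hq : q ∈ Dom n) {k : WithTop ℕ∞} :
    ContDiffAt ℝ k (vv : Spacetime n → ℝ) q := by
  have := contDiffAt_r hq (k := k)
  unfold vv
  fun_prop

theorem contDiffAt_uu {n : ℕ} {q : Spacetime n} (hq : q ∈ Dom n) {k : WithTop ℕ∞} :
    ContDiffAt ℝ k (uu : Spacetime n → ℝ) q := by
  have := contDiffAt_r hq (k := k)
  unfold uu
  fun_prop

theorem contDiffAt_ls {n : ℕ} {q : Spacetime n} (hq : q ∈ Dom n) {k : WithTop ℕ∞} :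
    ContDiffAt ℝ k (ls : Spacetime n → ℝ) q :=
  ((contDiffAt_vv hq).log (vv_pos hq).ne').add ((contDiffAt_uu hq).neg.log (uu_neg hq).ne')
    |>.div_const 2

theorem contDiffAt_lt {n : ℕ} {q : Spacetime n} (hq : q ∈ Dom n) {k : WithTop ℕ∞} :
    ContDiffAt ℝ k (lt : Spacetime n → ℝ) q :=
  ((contDiffAt_vv hq).log (vv_pos hq).ne').sub ((contDiffAt_uu hq).neg.log (uu_neg hq).ne')
    |>.div_const 2

theorem diff_ls {n : ℕ} {q : Spacetime n} (hq : q ∈ Dom n) :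
    DifferentiableAt ℝ (ls : Spacetime n → ℝ) q :=
  (contDiffAt_ls hq (k := 1)).differentiableAt (by simp)

theorem diff_lt {n : ℕ} {q : Spacetime n} (hq : q ∈ Dom n) :
    DifferentiableAt ℝ (lt : Spacetime n → ℝ) q :=
  (contDiffAt_lt hq (k := 1)).differentiableAt (by simp)

theorem norm_sq_sum {n : ℕ} (q : Spacetime n) : ‖q.2‖ ^ 2 = ∑ i, q.2 i * q.2 i := by
  rw [EuclideanSpace.real_norm_sq_eq]
  exact Finset.sum_congr rfl fun i _ => by ring

/-- derivative of `r` in the coordinate directions -/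
def rd {n : ℕ} (m : Option (Fin n)) (q : Spacetime n) : ℝ :=
  match m with
  | none => 0
  | some i => q.2 i / ‖q.2‖

/-- derivative of `t` in the coordinate directions -/
def td {n : ℕ} (m : Option (Fin n)) : ℝ :=
  match m with
  | none => 1
  | some _ => 0

theorem pd_r {n : ℕ} {q : Spacetime n} (hq : q ∈ Dom n) (m : Option (Fin n)) :
    pd m (fun q : Spacetime n => ‖q.2‖) q = rd m q := by
  have hr := norm_pos_Dom hq
  have hd : DifferentiableAt ℝ (fun q : Spacetime n => ‖q.2‖) q :=
    (contDiffAt_r hq (k := 1)).differentiableAt (by simp)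
  have h1 : pd m (fun x : Spacetime n => ‖x.2‖ * ‖x.2‖) q
      = 2 * ‖q.2‖ * pd m (fun q : Spacetime n => ‖q.2‖) q := by
    rw [pd_mul m hd hd]; ring
  have h2 : (fun x : Spacetime n => ‖x.2‖ * ‖x.2‖)
      = fun x => ∑ i, co (some i) x * co (some i) x := by
    funext x
    rw [← sq, norm_sq_sum]; rfl
  have h3 : pd m (fun x : Spacetime n => ‖x.2‖ * ‖x.2‖) q = 2 * ‖q.2‖ * rd m q := by
    rw [h2, pd_sum m fun i => (diff_co (some i) q).fun_mul (diff_co (some i) q)]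
    have : ∀ i, pd m (fun x => co (some i) x * co (some i) x) q
        = if some i = m then 2 * q.2 i else 0 := by
      intro i
      rw [pd_mul m (diff_co (some i) q) (diff_co (some i) q), pd_co]
      have : co (some i) q = q.2 i := rfl
      rw [this]
      split_ifs <;> ring
    simp only [this]
    cases m with
    | none => simp [rd]
    | some j =>
      simp [rd]
      field_simp
  have : 2 * ‖q.2‖ * pd m (fun q : Spacetime n => ‖q.2‖) q = 2 * ‖q.2‖ * rd m q := by
    rw [← h1, h3]
  exact mul_left_cancel₀ (by positivity) this

theorem pd_t {n : ℕ} (q : Spacetime n) (m : Option (Fin n)) :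
    pd m (fun q : Spacetime n => q.1) q = td m := by
  have : (fun q : Spacetime n => q.1) = co none := rfl
  rw [this, pd_co]
  cases m <;> simp [td]

theorem pd_log_vv {n : ℕ} {q : Spacetime n} (hq : q ∈ Dom n) (m : Option (Fin n)) :
    pd m (fun q : Spacetime n => Real.log (vv q)) q = (vv q)⁻¹ * ((td m + rd m q) / 2) := by
  have hd : DifferentiableAt ℝ (fun q : Spacetime n => ‖q.2‖) q :=
    (contDiffAt_r hq (k := 1)).differentiableAt (by simp)
  have ht : DifferentiableAt ℝ (fun q : Spacetime n => q.1) q := by fun_prop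
  have hc : DifferentiableAt ℝ (fun _ : Spacetime n => (1 / 2 : ℝ)) q := by fun_prop
  rw [pd_comp m (Real.hasDerivAt_log (vv_pos hq).ne')
    ((contDiffAt_vv hq (k := 1)).differentiableAt (by simp))]
  have e : (vv : Spacetime n → ℝ) = fun q => (q.1 + ‖q.2‖) * (1 / 2 : ℝ) := by
    funext q; unfold vv; ring
  have : pd m (vv : Spacetime n → ℝ) q = (td m + rd m q) / 2 := by
    rw [e, pd_mul m (ht.fun_add hd) hc, pd_add m ht hd, pd_t, pd_r hq, pd_const]
    ring
  rw [this]

theorem pd_log_uu {n : ℕ} {q : Spacetime n} (hq : q ∈ Dom n) (m : Option (Fin n)) :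
    pd m (fun q : Spacetime n => Real.log (-uu q)) q = (-uu q)⁻¹ * ((rd m q - td m) / 2) := by
  have hd : DifferentiableAt ℝ (fun q : Spacetime n => ‖q.2‖) q :=
    (contDiffAt_r hq (k := 1)).differentiableAt (by simp)
  have ht : DifferentiableAt ℝ (fun q : Spacetime n => q.1) q := by fun_prop
  have hc : DifferentiableAt ℝ (fun _ : Spacetime n => (1 / 2 : ℝ)) q := by fun_prop
  have e : (fun q : Spacetime n => -uu q) = fun q => (‖q.2‖ - q.1) * (1 / 2 : ℝ) := by
    funext q; unfold uu; ring
  have hu : DifferentiableAt ℝ (fun q : Spacetime n => -uu q) q :=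
    (contDiffAt_uu hq (k := 1)).neg.differentiableAt (by simp)
  have := pd_comp m (f := fun q : Spacetime n => -uu q) (Real.hasDerivAt_log (uu_neg hq).ne') hu
  rw [this]
  have : pd m (fun q : Spacetime n => -uu q) q = (rd m q - td m) / 2 := by
    rw [e, pd_mul m (hd.fun_sub ht) hc, pd_sub m hd ht, pd_t, pd_r hq, pd_const]
    ring
  rw [this]

theorem pd_ls {n : ℕ} {q : Spacetime n} (hq : q ∈ Dom n) (m : Option (Fin n)) :
    pd m ls q = (‖q.2‖ * rd m q - q.1 * td m) / yy q := by
  have hv : DifferentiableAt ℝ (fun q : Spacetime n => Real.log (vv q)) q :=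
    ((contDiffAt_vv hq (k := 1)).log (vv_pos hq).ne').differentiableAt (by simp)
  have hu : DifferentiableAt ℝ (fun q : Spacetime n => Real.log (-uu q)) q :=
    ((contDiffAt_uu hq (k := 1)).neg.log (uu_neg hq).ne').differentiableAt (by simp)
  have hc : DifferentiableAt ℝ (fun _ : Spacetime n => (1 / 2 : ℝ)) q := by fun_prop
  have e : (ls : Spacetime n → ℝ) =
      fun q => (Real.log (vv q) + Real.log (-uu q)) * (1 / 2 : ℝ) := by
    funext q; unfold ls; ring
  rw [e, pd_mul m (hv.fun_add hu) hc, pd_add m hv hu, pd_const, pd_log_vv hq, pd_log_uu hq, yy_eq]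
  have h1 := (vv_pos hq).ne'
  have h2 : uu q ≠ 0 := fun h => by have := uu_neg hq; simp [h] at this
  field_simp
  unfold vv uu
  ring

theorem pd_lt {n : ℕ} {q : Spacetime n} (hq : q ∈ Dom n) (m : Option (Fin n)) :
    pd m lt q = (‖q.2‖ * td m - q.1 * rd m q) / yy q := by
  have hv : DifferentiableAt ℝ (fun q : Spacetime n => Real.log (vv q)) q :=
    ((contDiffAt_vv hq (k := 1)).log (vv_pos hq).ne').differentiableAt (by simp)
  have hu : DifferentiableAt ℝ (fun q : Spacetime n => Real.log (-uu q)) q :=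
    ((contDiffAt_uu hq (k := 1)).neg.log (uu_neg hq).ne').differentiableAt (by simp)
  have hc : DifferentiableAt ℝ (fun _ : Spacetime n => (1 / 2 : ℝ)) q := by fun_prop
  have e : (lt : Spacetime n → ℝ) =
      fun q => (Real.log (vv q) - Real.log (-uu q)) * (1 / 2 : ℝ) := by
    funext q; unfold lt; ring
  rw [e, pd_mul m (hv.fun_sub hu) hc, pd_sub m hv hu, pd_const, pd_log_vv hq, pd_log_uu hq, yy_eq]
  have h1 := (vv_pos hq).ne'
  have h2 : uu q ≠ 0 := fun h => by have := uu_neg hq; simp [h] at this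
  field_simp
  unfold vv uu
  ring

theorem sum_rd {n : ℕ} {q : Spacetime n} (φ : Spacetime n → ℝ) :
    ∑ i : Fin n, rd (some i) q * pd (some i) φ q = dr φ q := by
  unfold dr
  rw [Finset.sum_div]
  refine Finset.sum_congr rfl fun i _ => ?_
  have : pd (some i) φ q = dx i φ q := rfl
  rw [this]
  simp only [rd]
  ring

theorem sum_xrd {n : ℕ} {q : Spacetime n} (hq : q ∈ Dom n) :
    ∑ i : Fin n, q.2 i * rd (some i) q = ‖q.2‖ := by
  have hr := norm_pos_Dom hq
  have : ∀ i : Fin n, q.2 i * rd (some i) q = (q.2 i * q.2 i) / ‖q.2‖ := fun i => by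
    simp only [rd]; ring
  simp only [this]
  rw [← Finset.sum_div, ← norm_sq_sum]
  field_simp

theorem Sf_eq {n : ℕ} {q : Spacetime n} (hq : q ∈ Dom n) (φ : Spacetime n → ℝ) :
    Sf φ q = q.1 * dt φ q + ‖q.2‖ * dr φ q := by
  have hr := norm_pos_Dom hq
  unfold Sf
  rw [Fintype.sum_option]
  unfold dr
  rw [mul_div_cancel₀ _ hr.ne']
  rfl

theorem mf_ls {n : ℕ} {q : Spacetime n} (hq : q ∈ Dom n) (φ : Spacetime n → ℝ) :
    mf ls φ q = Sf φ q / yy q := by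
  rw [Sf_eq hq]
  unfold mf
  rw [Fintype.sum_option]
  simp only [pd_ls hq]
  have : ∀ i : Fin n, et (some i) * ((‖q.2‖ * rd (some i) q - q.1 * td (some i)) / yy q
      * pd (some i) φ q) = ‖q.2‖ / yy q * (rd (some i) q * pd (some i) φ q) := fun i => by
    simp only [et, td]; ring
  simp only [this]
  rw [← Finset.mul_sum, sum_rd]
  have : pd none φ q = dt φ q := rfl
  rw [this]
  simp only [et, td, rd]
  ring

theorem mf_lt {n : ℕ} {q : Spacetime n} (hq : q ∈ Dom n) (φ : Spacetime n → ℝ) :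
    mf lt φ q = - (Tf φ q / yy q) := by
  unfold mf Tf
  rw [Fintype.sum_option]
  simp only [pd_lt hq]
  have : ∀ i : Fin n, et (some i) * ((‖q.2‖ * td (some i) - q.1 * rd (some i) q) / yy q
      * pd (some i) φ q) = -(q.1 / yy q) * (rd (some i) q * pd (some i) φ q) := fun i => by
    simp only [et, td]; ring
  simp only [this]
  rw [← Finset.mul_sum, sum_rd]
  have : pd none φ q = dt φ q := rfl
  rw [this]
  simp only [et, td, rd]
  ring

theorem Sf_ls {n : ℕ} {q : Spacetime n} (hq : q ∈ Dom n) : Sf ls q = 1 := by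
  have hy := (yy_pos hq).ne'
  unfold Sf
  rw [Fintype.sum_option]
  simp only [pd_ls hq]
  have : ∀ i : Fin n, co (some i) q * ((‖q.2‖ * rd (some i) q - q.1 * td (some i)) / yy q)
      = ‖q.2‖ / yy q * (q.2 i * rd (some i) q) := fun i => by
    simp only [co, td]; ring
  simp only [this]
  rw [← Finset.mul_sum, sum_xrd hq]
  simp only [co, td, rd]
  field_simp
  unfold yy
  ring

theorem Sf_lt {n : ℕ} {q : Spacetime n} (hq : q ∈ Dom n) : Sf lt q = 0 := by
  have hy := (yy_pos hq).ne'
  unfold Sf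
  rw [Fintype.sum_option]
  simp only [pd_lt hq]
  have : ∀ i : Fin n, co (some i) q * ((‖q.2‖ * td (some i) - q.1 * rd (some i) q) / yy q)
      = - (q.1 / yy q) * (q.2 i * rd (some i) q) := fun i => by
    simp only [co, td]; ring
  simp only [this]
  rw [← Finset.mul_sum, sum_xrd hq]
  simp only [co, td, rd]
  ring

theorem Qf_eq {n : ℕ} {q : Spacetime n} (hq : q ∈ Dom n) (φ : Spacetime n → ℝ) :
    Qf φ q = (Sf φ q ^ 2 - Tf φ q ^ 2) / yy q + angSq φ q := by
  have hy := (yy_pos hq).ne'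
  have h1 : Sf φ q ^ 2 - Tf φ q ^ 2 = yy q * (dr φ q ^ 2 - dt φ q ^ 2) := by
    rw [Sf_eq hq]; unfold Tf yy; ring
  rw [h1, mul_div_cancel_left₀ _ hy]
  unfold Qf angSq
  rw [Fintype.sum_option]
  have e1 : pd none φ q = dt φ q := rfl
  have e2 : ∀ i : Fin n, pd (some i) φ q = dx i φ q := fun i => rfl
  simp only [e1, e2, et, one_mul]
  have : ∀ i : Fin n, dx i φ q * dx i φ q = dx i φ q ^ 2 := fun i => by ring
  simp only [this]
  ring

theorem angSq_nonneg {n : ℕ} {q : Spacetime n} (hq : q ∈ Dom n) (φ : Spacetime n → ℝ) :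
    0 ≤ angSq φ q := by
  have hr := norm_pos_Dom hq
  unfold angSq dr
  have := Finset.sum_mul_sq_le_sq_mul_sq Finset.univ (fun i => q.2 i) (fun i => dx i φ q)
  rw [← EuclideanSpace.real_norm_sq_eq] at this
  rw [div_pow, sub_nonneg, div_le_iff₀ (by positivity)]
  linarith

theorem Sf_uv {n : ℕ} {q : Spacetime n} (hq : q ∈ Dom n) (φ : Spacetime n → ℝ) :
    Sf φ q = uu q * du φ q + vv q * dv φ q := by
  rw [Sf_eq hq]; unfold uu vv du dv; ring

theorem Tf_uv {n : ℕ} (q : Spacetime n) (φ : Spacetime n → ℝ) :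
    Tf φ q = vv q * dv φ q - uu q * du φ q := by
  unfold Tf uu vv du dv; ring

theorem pd_AT {n : ℕ} {q : Spacetime n} (hq : q ∈ Dom n) {A H : ℝ → ℝ} {A' H' : ℝ}
    (hA : HasDerivAt A A' (ls q)) (hH : HasDerivAt H H' (lt q)) (m : Option (Fin n)) :
    pd m (fun x => A (ls x) * H (lt x)) q
      = A' * H (lt q) * pd m ls q + A (ls q) * H' * pd m lt q := by
  have h1 : DifferentiableAt ℝ (fun x : Spacetime n => A (ls x)) q :=
    hA.differentiableAt.comp q (diff_ls hq)
  have h2 : DifferentiableAt ℝ (fun x : Spacetime n => H (lt x)) q :=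
    hH.differentiableAt.comp q (diff_lt hq)
  rw [pd_mul m h1 h2, pd_comp m hA (diff_ls hq), pd_comp m hH (diff_lt hq)]
  ring

theorem mf_AT {n : ℕ} {q : Spacetime n} (hq : q ∈ Dom n) {A H : ℝ → ℝ} {A' H' : ℝ}
    (hA : HasDerivAt A A' (ls q)) (hH : HasDerivAt H H' (lt q)) (φ : Spacetime n → ℝ) :
    mf (fun x => A (ls x) * H (lt x)) φ q
      = (A' * H (lt q) * Sf φ q - A (ls q) * H' * Tf φ q) / yy q := by
  have : mf (fun x => A (ls x) * H (lt x)) φ q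
      = A' * H (lt q) * mf ls φ q + A (ls q) * H' * mf lt φ q := by
    unfold mf
    rw [Finset.mul_sum, Finset.mul_sum, ← Finset.sum_add_distrib]
    refine Finset.sum_congr rfl fun l _ => ?_
    rw [pd_AT hq hA hH]; ring
  rw [this, mf_ls hq, mf_lt hq]; ring

theorem Sf_AT {n : ℕ} {q : Spacetime n} (hq : q ∈ Dom n) {A H : ℝ → ℝ} {A' H' : ℝ}
    (hA : HasDerivAt A A' (ls q)) (hH : HasDerivAt H H' (lt q)) :
    Sf (fun x => A (ls x) * H (lt x)) q = A' * H (lt q) := by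
  have : Sf (fun x => A (ls x) * H (lt x)) q
      = A' * H (lt q) * Sf ls q + A (ls q) * H' * Sf lt q := by
    unfold Sf
    rw [Finset.mul_sum, Finset.mul_sum, ← Finset.sum_add_distrib]
    refine Finset.sum_congr rfl fun l _ => ?_
    rw [pd_AT hq hA hH]; ring
  rw [this, Sf_ls hq, Sf_lt hq]; ring

theorem mf_A {n : ℕ} {q : Spacetime n} (hq : q ∈ Dom n) {A : ℝ → ℝ} {A' : ℝ}
    (hA : HasDerivAt A A' (ls q)) (φ : Spacetime n → ℝ) :
    mf (fun x => A (ls x)) φ q = A' * Sf φ q / yy q := by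
  have := mf_AT hq hA (hasDerivAt_const (lt q) (1 : ℝ)) φ
  simpa using this

/-! ### The weighted identity -/

/-- The density (one-dimensional profile) of the lower order current. -/
def Ew (K F h h1 : ℝ → ℝ) (c : ℝ) (s : ℝ) : ℝ :=
  K s * (Real.exp (2 * F s - 2 * s) * (2 * h s * (c + h s) - h1 s)) / 8

/-- The first order profile. -/
def Aw (K F : ℝ → ℝ) (s : ℝ) : ℝ := K s * Real.exp (2 * F s)

theorem hasDerivAt_Aw {K F : ℝ → ℝ} {s Kd h : ℝ} (hK : HasDerivAt K Kd s)
    (hF : HasDerivAt F h s) :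
    HasDerivAt (Aw K F) ((Kd + 2 * h * K s) * Real.exp (2 * F s)) s := by
  have := hK.mul ((hF.const_mul 2).exp)
  refine HasDerivAt.congr_deriv this ?_
  ring

theorem hasDerivAt_Ew {K F h h1 : ℝ → ℝ} {s Kd h2 : ℝ} (c : ℝ) (hK : HasDerivAt K Kd s)
    (hF : HasDerivAt F (h s) s) (hh : HasDerivAt h (h1 s) s) (hh1 : HasDerivAt h1 h2 s) :
    HasDerivAt (Ew K F h h1 c)
      (((Kd + K s * (2 * h s - 2)) * (2 * h s * (c + h s) - h1 s)
        + K s * (2 * h1 s * (c + h s) + 2 * h s * h1 s - h2)) * Real.exp (2 * F s - 2 * s) / 8)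
      s := by
  have e1 := ((hF.const_mul 2).sub ((hasDerivAt_id s).const_mul 2)).exp
  have e2 := ((hh.const_mul 2).mul (hh.const_add c)).sub hh1
  have := (hK.mul (e1.mul e2)).div_const 8
  refine HasDerivAt.congr_deriv this ?_
  simp
  ring

theorem weighted_identity {n : ℕ} {φ : Spacetime n → ℝ} {q : Spacetime n} (hq : q ∈ Dom n)
    (hφ : ContDiffAt ℝ 2 φ q) {K H F h h1 : ℝ → ℝ} {Kd Hd h2 : ℝ}
    (hK : HasDerivAt K Kd (ls q)) (hH : HasDerivAt H Hd (lt q))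
    (hF : HasDerivAt F (h (ls q)) (ls q)) (hh : HasDerivAt h (h1 (ls q)) (ls q))
    (hh1 : HasDerivAt h1 h2 (ls q)) (c : ℝ) (hc : c = ((n : ℝ) - 1) / 2) :
    ∑ m, pd m (Jf (fun x => Aw K F (ls x) * H (lt x)) (fun x => c + h (ls x))
        (fun x => Ew K F h h1 c (ls x) * H (lt x)) φ m) q =
      Real.exp (2 * F (ls q)) / yy q *
        (K (ls q) * H (lt q) *
          (2 * h (ls q) * (Sf φ q + (c + h (ls q)) * φ q) ^ 2
            + (h (ls q) * h1 (ls q) - h2 / 2) * φ q ^ 2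
            + (Sf φ q + (c + h (ls q)) * φ q) * (yy q * box φ q))
        + ((Sf φ q + (c + h (ls q)) * φ q) * (Kd * H (lt q) * Sf φ q - K (ls q) * Hd * Tf φ q)
          - 1 / 2 * (Kd * H (lt q)) * (Sf φ q ^ 2 - Tf φ q ^ 2 + yy q * angSq φ q)
          + 1 / 2 * (2 * h (ls q) * (c + h (ls q)) - h1 (ls q)) * φ q ^ 2 * (Kd * H (lt q)))) := by
  have hA := hasDerivAt_Aw hK hF
  have hE := hasDerivAt_Ew c hK hF hh hh1
  have hg : HasDerivAt (fun s => c + h s) (h1 (ls q)) (ls q) := hh.const_add c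
  have dA : DifferentiableAt ℝ (fun x : Spacetime n => Aw K F (ls x)) q :=
    hA.differentiableAt.comp q (diff_ls hq)
  have dE : DifferentiableAt ℝ (fun x : Spacetime n => Ew K F h h1 c (ls x)) q :=
    hE.differentiableAt.comp q (diff_ls hq)
  have dH : DifferentiableAt ℝ (fun x : Spacetime n => H (lt x)) q :=
    hH.differentiableAt.comp q (diff_lt hq)
  have dg : DifferentiableAt ℝ (fun x : Spacetime n => c + h (ls x)) q :=
    hg.differentiableAt.comp (f := ls) q (diff_ls hq)
  rw [div_Jf hφ (dA.fun_mul dH) dg (dE.fun_mul dH), mf_AT hq hA hH, mf_A hq hg, Sf_AT hq hA hH,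
    Sf_AT hq hE hH, Qf_eq hq]
  have hy := (yy_pos hq).ne'
  have hexp : Real.exp (2 * F (ls q) - 2 * ls q) = 4 * Real.exp (2 * F (ls q)) / yy q := by
    rw [yy_exp hq, Real.exp_sub]; field_simp
  have hn : (n : ℝ) = 2 * c + 1 := by rw [hc]; ring
  unfold Ew Aw
  rw [hexp, hn]
  generalize Real.exp (2 * F (ls q)) = X
  generalize yy q = y at *
  generalize Sf φ q = S
  generalize Tf φ q = T
  field_simp
  ring

/-! ### The weight and the cutoff -/

theorem exists_weight (p δ : ℝ) (hp : 0 < p) (hδ : 0 < δ) (hδp : δ ≤ p / 4) :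
    ∃ F h h1 h2 : ℝ → ℝ,
      (∀ s, HasDerivAt F (h s) s) ∧ (∀ s, HasDerivAt h (h1 s) s) ∧
      (∀ s, HasDerivAt h1 (h2 s) s) ∧ ContDiff ℝ 1 F ∧ ContDiff ℝ 1 h ∧ ContDiff ℝ 1 h1 ∧
      (∀ s, p - δ ≤ h s) ∧ (∀ s, h s ≤ p + δ) ∧ (∀ s, |h1 s| ≤ p ^ 2) ∧
      (∀ s, δ * p ^ 2 / 8 * min (Real.exp (p * s)) (Real.exp (-(p * s)))
        ≤ h s * h1 s - h2 s / 2) ∧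
      (∃ C, 0 ≤ C ∧ ∀ s, Real.exp (2 * F s)
        ≤ C * (Real.exp (2 * s * (p - δ)) + Real.exp (2 * s * (p + δ)))) := by
  set L : ℝ → ℝ := fun s => Real.exp (p * s) / (1 + Real.exp (p * s)) with hL
  have hpos : ∀ s, 0 < 1 + Real.exp (p * s) := fun s => by positivity
  have L0 : ∀ s, 0 < L s := fun s => by simp only [hL]; positivity
  have L1 : ∀ s, 0 < 1 - L s := fun s => by
    have : 1 - L s = 1 / (1 + Real.exp (p * s)) := by
      simp only [hL]; field_simp; ring
    rw [this]; positivity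
  have dexp : ∀ s, HasDerivAt (fun s => Real.exp (p * s)) (p * Real.exp (p * s)) s := fun s => by
    have := ((hasDerivAt_id s).const_mul p).exp
    refine HasDerivAt.congr_deriv this ?_
    simp; ring
  have dL : ∀ s, HasDerivAt L (p * (L s * (1 - L s))) s := fun s => by
    have := (dexp s).div ((dexp s).const_add 1) (hpos s).ne'
    refine HasDerivAt.congr_deriv this ?_
    simp only [hL]
    have := (hpos s).ne'
    field_simp
  have cL : ContDiff ℝ 1 L := by
    have : ContDiff ℝ 1 (fun s => Real.exp (p * s)) := by fun_prop
    exact this.div (contDiff_const.add this) (fun s => (hpos s).ne')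
  have hLL : ∀ s, 0 < L s * (1 - L s) := fun s => mul_pos (L0 s) (L1 s)
  refine ⟨fun s => (p - δ) * s + 2 * δ / p * Real.log (1 + Real.exp (p * s)),
    fun s => p - δ + 2 * δ * L s, fun s => 2 * δ * p * (L s * (1 - L s)),
    fun s => 2 * δ * p ^ 2 * (L s * (1 - L s)) * (1 - 2 * L s), ?_, ?_, ?_, ?_, ?_, ?_, ?_, ?_, ?_,
    ?_, ?_⟩
  · intro s
    have := ((hasDerivAt_id s).const_mul (p - δ)).add
      ((((dexp s).const_add 1).log (hpos s).ne').const_mul (2 * δ / p))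
    refine HasDerivAt.congr_deriv this ?_
    simp only [hL]
    field_simp
  · intro s
    refine HasDerivAt.congr_deriv (((dL s).const_mul (2 * δ)).const_add (p - δ)) ?_
    ring
  · intro s
    refine HasDerivAt.congr_deriv
      (((dL s).mul ((dL s).const_sub 1)).const_mul (2 * δ * p)) ?_
    ring
  · have : ContDiff ℝ 1 (fun s => Real.log (1 + Real.exp (p * s))) :=
      ContDiff.log (by fun_prop) (fun s => (hpos s).ne')
    fun_prop
  · fun_prop
  · fun_prop
  · intro s
    have := L0 s
    have : 0 < 2 * δ * L s := by positivity
    show _ ≤ p - δ + 2 * δ * L s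
    linarith
  · intro s
    have := L1 s
    have : 0 < 2 * δ * (1 - L s) := by positivity
    show p - δ + 2 * δ * L s ≤ _
    linarith
  · intro s
    have h1 := hLL s
    have h2 : L s * (1 - L s) ≤ 1 / 4 := by nlinarith [sq_nonneg (L s - 1 / 2)]
    show |2 * δ * p * (L s * (1 - L s))| ≤ _
    rw [abs_of_pos (by positivity)]
    calc 2 * δ * p * (L s * (1 - L s)) ≤ 2 * δ * p * (1 / 4) := by gcongr
      _ ≤ 2 * (p / 4) * p * (1 / 4) := by gcongr
      _ ≤ p ^ 2 := by nlinarith [sq_nonneg p]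
  · intro s
    have h1 := hLL s
    have key : 1 / 4 * min (Real.exp (p * s)) (Real.exp (-(p * s))) ≤ L s * (1 - L s) := by
      have e : L s * (1 - L s) = Real.exp (p * s) / (1 + Real.exp (p * s)) ^ 2 := by
        simp only [hL]; field_simp; ring
      rw [e, le_div_iff₀ (by positivity), Real.exp_neg]
      have hX : 0 < Real.exp (p * s) := Real.exp_pos _
      generalize Real.exp (p * s) = X at hX
      rcases le_total X 1 with hx | hx
      · calc 1 / 4 * min X X⁻¹ * (1 + X) ^ 2 ≤ 1 / 4 * X * (1 + 1) ^ 2 := by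
              gcongr; exact min_le_left _ _
          _ = X := by ring
      · calc 1 / 4 * min X X⁻¹ * (1 + X) ^ 2 ≤ 1 / 4 * X⁻¹ * (X + X) ^ 2 := by
              gcongr; exact min_le_right _ _
          _ = X := by field_simp; ring
    have e2 : (p - δ + 2 * δ * L s) * (2 * δ * p * (L s * (1 - L s)))
        - 2 * δ * p ^ 2 * (L s * (1 - L s)) * (1 - 2 * L s) / 2
        = 2 * δ * p * (L s * (1 - L s)) * (p / 2 - δ + 2 * δ * L s + p * L s) := by ring
    show _ ≤ (p - δ + 2 * δ * L s) * (2 * δ * p * (L s * (1 - L s)))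
        - 2 * δ * p ^ 2 * (L s * (1 - L s)) * (1 - 2 * L s) / 2
    rw [e2]
    have hl := L0 s
    have h3 : p / 4 ≤ p / 2 - δ + 2 * δ * L s + p * L s := by
      have : 0 < 2 * δ * L s := by positivity
      have : 0 < p * L s := by positivity
      linarith
    calc δ * p ^ 2 / 8 * min (Real.exp (p * s)) (Real.exp (-(p * s)))
        = 2 * δ * p * (1 / 4 * min (Real.exp (p * s)) (Real.exp (-(p * s)))) * (p / 4) := by ring
      _ ≤ 2 * δ * p * (L s * (1 - L s)) * (p / 4) := by gcongr
      _ ≤ _ := by gcongr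
  · refine ⟨Real.exp (4 * δ / p * Real.log 2), (Real.exp_pos _).le, fun s => ?_⟩
    have hb : ∀ M, 0 ≤ M → p * s ≤ M → Real.log (1 + Real.exp (p * s)) ≤ Real.log 2 + M := by
      intro M hM hs
      have e1 : Real.exp (p * s) ≤ Real.exp M := Real.exp_le_exp.2 hs
      have e2 : 1 ≤ Real.exp M := Real.one_le_exp hM
      have : Real.log (1 + Real.exp (p * s)) ≤ Real.log (2 * Real.exp M) :=
        Real.log_le_log (hpos s) (by linarith)
      rwa [Real.log_mul (by norm_num) (Real.exp_pos _).ne', Real.log_exp] at this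
    have hdp : 0 < 2 * δ / p := by positivity
    rw [mul_add (Real.exp _), ← Real.exp_add, ← Real.exp_add]
    rcases le_total s 0 with hs | hs
    · have h1 := hb 0 le_rfl (mul_nonpos_of_nonneg_of_nonpos hp.le hs)
      have h2 := mul_le_mul_of_nonneg_left h1 hdp.le
      refine le_trans (Real.exp_le_exp.2 ?_) (le_add_of_nonneg_right (Real.exp_pos _).le)
      have e : 4 * δ / p * Real.log 2 = 2 * (2 * δ / p * (Real.log 2 + 0)) := by ring
      rw [e]
      linarith
    · have h1 := hb (p * s) (by positivity) le_rfl
      have h2 := mul_le_mul_of_nonneg_left h1 hdp.le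
      refine le_trans (Real.exp_le_exp.2 ?_) (le_add_of_nonneg_left (Real.exp_pos _).le)
      have e : 2 * δ / p * (Real.log 2 + p * s) = 2 * δ / p * Real.log 2 + 2 * δ * s := by
        field_simp
      rw [e] at h2
      have e : 4 * δ / p * Real.log 2 = 2 * (2 * δ / p * Real.log 2) := by ring
      rw [e]
      linarith

/-- `C¹` cutoff. -/
def kap (x : ℝ) : ℝ := (max (1 - x ^ 2) 0) ^ 2

/-- Derivative of the cutoff. -/
def kapd (x : ℝ) : ℝ := -4 * x * max (1 - x ^ 2) 0

theorem hasDerivAt_sqpos (y : ℝ) : HasDerivAt (fun y : ℝ => (max y 0) ^ 2) (2 * max y 0) y := by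
  rcases lt_trichotomy y 0 with hy | hy | hy
  · have : (fun y : ℝ => (max y 0) ^ 2) =ᶠ[nhds y] fun _ => 0 := by
      filter_upwards [Iio_mem_nhds hy] with z hz
      rw [max_eq_right (le_of_lt hz)]; simp
    rw [max_eq_right hy.le]
    simpa using (hasDerivAt_const y (0 : ℝ)).congr_of_eventuallyEq this
  · subst hy
    simp only [max_self, mul_zero]
    rw [hasDerivAt_iff_isLittleO_nhds_zero]
    simp only [zero_add, max_self, smul_zero, sub_zero]
    have h1 : (fun h : ℝ => (max h 0) ^ 2) =O[nhds 0] fun h : ℝ => h ^ 2 := by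
      refine Asymptotics.isBigO_of_le _ fun h => ?_
      rw [norm_pow, norm_pow]
      gcongr
      rw [Real.norm_eq_abs, Real.norm_eq_abs, abs_of_nonneg (le_max_right _ _)]
      exact max_le (le_abs_self h) (abs_nonneg h)
    have h2 : (fun h : ℝ => h ^ 2) =o[nhds 0] fun h : ℝ => h := by
      simpa using Asymptotics.isLittleO_pow_id (𝕜 := ℝ) (n := 2) (by norm_num)
    simpa using h1.trans_isLittleO h2
  · have : (fun y : ℝ => (max y 0) ^ 2) =ᶠ[nhds y] fun y => y ^ 2 := by
      filter_upwards [Ioi_mem_nhds hy] with z hz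
      rw [max_eq_left (le_of_lt hz)]
    rw [max_eq_left hy.le]
    simpa using (hasDerivAt_pow 2 y).congr_of_eventuallyEq this

theorem hasDerivAt_kap (x : ℝ) : HasDerivAt kap (kapd x) x := by
  have h1 : HasDerivAt (fun x : ℝ => 1 - x ^ 2) (-(2 * x)) x := by
    simpa using (hasDerivAt_pow 2 x).const_sub 1
  have := (hasDerivAt_sqpos (1 - x ^ 2)).comp x h1
  refine HasDerivAt.congr_deriv this ?_
  unfold kapd; ring

theorem kap_nonneg (x : ℝ) : 0 ≤ kap x := by unfold kap; positivity

theorem kap_le_one (x : ℝ) : kap x ≤ 1 := by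
  unfold kap
  have h1 : max (1 - x ^ 2) 0 ≤ 1 := max_le (by nlinarith [sq_nonneg x]) zero_le_one
  have h0 : 0 ≤ max (1 - x ^ 2) 0 := le_max_right _ _
  exact pow_le_one₀ h0 h1

theorem kap_eq_zero {x : ℝ} (h : 1 ≤ |x|) : kap x = 0 := by
  unfold kap
  have : 1 ≤ x ^ 2 := by rw [← sq_abs]; nlinarith [abs_nonneg x]
  rw [max_eq_right (by linarith)]; simp

theorem kap_pos {x : ℝ} (h : |x| < 1) : 0 < kap x := by
  unfold kap
  have : x ^ 2 < 1 := by rw [← sq_abs]; nlinarith [abs_nonneg x]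
  have : 0 < max (1 - x ^ 2) 0 := lt_max_of_lt_left (by linarith)
  positivity

theorem kapd_abs_le (x : ℝ) : |kapd x| ≤ 4 := by
  unfold kapd
  rcases le_total 1 |x| with h | h
  · have : 1 ≤ x ^ 2 := by rw [← sq_abs]; nlinarith [abs_nonneg x]
    rw [max_eq_right (by linarith)]; simp
  · have h1 : max (1 - x ^ 2) 0 ≤ 1 := max_le (by nlinarith [sq_nonneg x]) zero_le_one
    have h0 : 0 ≤ max (1 - x ^ 2) 0 := le_max_right _ _
    rw [abs_mul, abs_mul, abs_of_nonneg h0]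
    have : |(-4 : ℝ)| = 4 := by norm_num
    rw [this]
    nlinarith [abs_nonneg x]

theorem kapd_nonpos {x : ℝ} (h : 0 ≤ x) : kapd x ≤ 0 := by
  unfold kapd
  have h0 : 0 ≤ max (1 - x ^ 2) 0 := le_max_right _ _
  have := mul_nonneg h h0
  nlinarith

theorem contDiff_kap : ContDiff ℝ 1 kap := by
  rw [contDiff_one_iff_deriv]
  refine ⟨fun x => (hasDerivAt_kap x).differentiableAt, ?_⟩
  have : deriv kap = kapd := funext fun x => (hasDerivAt_kap x).deriv
  rw [this]
  unfold kapd
  fun_prop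

theorem kap_mono {x M N : ℝ} (hM : 0 < M) (hMN : M ≤ N) : kap (x / M) ≤ kap (x / N) := by
  unfold kap
  have : (x / N) ^ 2 ≤ (x / M) ^ 2 := by
    rw [div_pow, div_pow]
    gcongr
  have h0 : 0 ≤ max (1 - (x / M) ^ 2) 0 := le_max_right _ _
  gcongr

/-! ### Integrability of the dominating function -/

/-- One-dimensional dominating profile. -/
def fb (μ γ : ℝ) (a : ℝ) : ℝ := if 0 < a then a ^ (μ - 1) * (1 + a) ^ (-γ) else 0

theorem fb_nonneg (μ γ a : ℝ) : 0 ≤ fb μ γ a := by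
  unfold fb
  split_ifs <;> positivity

theorem measurable_fb (μ γ : ℝ) : Measurable (fb μ γ) := by
  unfold fb
  refine Measurable.ite measurableSet_Ioi ?_ measurable_const
  fun_prop

theorem integrable_fb {μ β : ℝ} (hμ : 0 < μ) (hβ : μ < β) : Integrable (fb μ β) := by
  have h1 : Integrable ((Set.Ioo (0 : ℝ) 1).indicator fun a => a ^ (μ - 1)) := by
    rw [integrable_indicator_iff measurableSet_Ioo,
      intervalIntegral.integrableOn_Ioo_rpow_iff zero_lt_one]
    linarith
  have h2 : Integrable ((Set.Ioi (1 / 2 : ℝ)).indicator fun a => a ^ (μ - 1 - β)) := by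
    rw [integrable_indicator_iff measurableSet_Ioi]
    exact integrableOn_Ioi_rpow_of_lt (by linarith) (by norm_num)
  refine (h1.add h2).mono' (measurable_fb μ β).aestronglyMeasurable
    (Filter.Eventually.of_forall fun a => ?_)
  rw [Real.norm_of_nonneg (fb_nonneg _ _ _)]
  have i1 : 0 ≤ (Set.Ioo (0 : ℝ) 1).indicator (fun a => a ^ (μ - 1)) a :=
    Set.indicator_apply_nonneg fun h => Real.rpow_nonneg h.1.le _
  have i2 : 0 ≤ (Set.Ioi (1 / 2 : ℝ)).indicator (fun a => a ^ (μ - 1 - β)) a :=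
    Set.indicator_apply_nonneg fun h =>
      Real.rpow_nonneg (le_trans (by norm_num) (le_of_lt (Set.mem_Ioi.1 h))) _
  simp only [Pi.add_apply]
  by_cases ha : 0 < a
  · by_cases ha1 : a < 1
    · have ha2 : a ∈ Set.Ioo (0 : ℝ) 1 := ⟨ha, ha1⟩
      rw [Set.indicator_of_mem ha2]
      have : fb μ β a ≤ a ^ (μ - 1) := by
        unfold fb
        rw [if_pos ha]
        have : (1 + a) ^ (-β) ≤ 1 := Real.rpow_le_one_of_one_le_of_nonpos (by linarith) (by linarith)
        exact mul_le_of_le_one_right (by positivity) this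
      linarith
    · have ha2 : a ∈ Set.Ioi (1 / 2 : ℝ) := by
        simp only [Set.mem_Ioi]; linarith
      rw [Set.indicator_of_mem ha2]
      have : fb μ β a ≤ a ^ (μ - 1 - β) := by
        unfold fb
        rw [if_pos ha, sub_eq_add_neg (μ - 1) β, Real.rpow_add ha]
        have : (1 + a) ^ (-β) ≤ a ^ (-β) :=
          Real.rpow_le_rpow_of_nonpos ha (by linarith) (by linarith)
        gcongr
      linarith
  · have : fb μ β a = 0 := by unfold fb; rw [if_neg ha]
    rw [this]; positivity

theorem integrable_fb2 {μ β : ℝ} (hμ : 0 < μ) (hβ : μ < β) :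
    Integrable (fun z : ℝ × ℝ => fb μ β ((z.2 - z.1) / 2) * fb μ β ((z.2 + z.1) / 2))
      (volume.prod volume) := by
  have hf := integrable_fb hμ hβ
  have hm := measurable_fb μ β
  have h1 : Integrable (fun z : ℝ × ℝ => fb μ β (z.2 / 2) * fb μ β (z.2 / 2 + z.1))
      (volume.prod volume) := by
    have hmeas : Measurable (fun z : ℝ × ℝ => fb μ β (z.2 / 2) * fb μ β (z.2 / 2 + z.1)) := by
      fun_prop
    rw [integrable_prod_iff' hmeas.aestronglyMeasurable]
    refine ⟨Filter.Eventually.of_forall fun r => ?_, ?_⟩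
    · have := (hf.comp_add_left (r / 2)).const_mul (fb μ β (r / 2))
      exact this
    · have : ∀ r : ℝ, ∫ t, ‖fb μ β (r / 2) * fb μ β (r / 2 + t)‖
          = ‖fb μ β (r / 2)‖ * ∫ t, ‖fb μ β t‖ := by
        intro r
        simp only [norm_mul]
        rw [integral_const_mul, integral_add_left_eq_self (fun t => ‖fb μ β t‖) (r / 2)]
      simp only [this]
      exact ((hf.comp_div (by norm_num : (2 : ℝ) ≠ 0)).norm).mul_const _
  have h2 := (measurePreserving_prod_neg_add (volume : Measure ℝ)
    (volume : Measure ℝ)).integrable_comp_of_integrable h1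
  refine h2.congr (Filter.Eventually.of_forall fun z => ?_)
  simp only [Function.comp]
  congr 2 <;> ring

theorem fb_radial {n : ℕ} (hn : 1 ≤ n) (μ β t r : ℝ) (hr : 0 < r) :
    r ^ (n - 1) * (fb μ ((n : ℝ) - 1 + β) ((r - t) / 2) * fb μ ((n : ℝ) - 1 + β) ((r + t) / 2))
      ≤ fb μ β ((r - t) / 2) * fb μ β ((r + t) / 2) := by
  by_cases h1 : 0 < (r - t) / 2
  · by_cases h2 : 0 < (r + t) / 2
    · have hrab : r ≤ (1 + (r - t) / 2) * (1 + (r + t) / 2) := by nlinarith [mul_pos h1 h2]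
      generalize (r - t) / 2 = a at *
      generalize (r + t) / 2 = b at *
      have ex : ∀ x : ℝ, 0 < x →
          fb μ β x = (1 + x) ^ (n - 1) * fb μ ((n : ℝ) - 1 + β) x := by
        intro x hx
        unfold fb
        rw [if_pos hx, if_pos hx]
        have : (1 + x) ^ (-β) = (1 + x) ^ (n - 1) * (1 + x) ^ (-((n : ℝ) - 1 + β)) := by
          rw [← Real.rpow_natCast, ← Real.rpow_add (by linarith)]
          congr 1
          rw [Nat.cast_sub hn]; push_cast; ring
        rw [this]; ring
      rw [ex a h1, ex b h2]
      have e : (1 + a) ^ (n - 1) * fb μ ((n : ℝ) - 1 + β) a *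
          ((1 + b) ^ (n - 1) * fb μ ((n : ℝ) - 1 + β) b)
          = ((1 + a) * (1 + b)) ^ (n - 1) *
            (fb μ ((n : ℝ) - 1 + β) a * fb μ ((n : ℝ) - 1 + β) b) := by
        rw [mul_pow]; ring
      rw [e]
      have := mul_nonneg (fb_nonneg μ ((n : ℝ) - 1 + β) a) (fb_nonneg μ ((n : ℝ) - 1 + β) b)
      gcongr
    · have : ∀ γ, fb μ γ ((r + t) / 2) = 0 := fun γ => by unfold fb; rw [if_neg h2]
      simp [this]
  · have : ∀ γ, fb μ γ ((r - t) / 2) = 0 := fun γ => by unfold fb; rw [if_neg h1]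
    simp [this]

theorem integrable_Gd {n : ℕ} (hn : 1 ≤ n) {μ β : ℝ} (hμ : 0 < μ) (hβ : μ < β) :
    Integrable (fun q : Spacetime n =>
      fb μ ((n : ℝ) - 1 + β) (-uu q) * fb μ ((n : ℝ) - 1 + β) (vv q)) := by
  set γ := (n : ℝ) - 1 + β with hγ
  have hm := measurable_fb μ γ
  have hd : Module.finrank ℝ (EuclideanSpace ℝ (Fin n)) = n := by simp
  have : Nontrivial (EuclideanSpace ℝ (Fin n)) := by
    apply Module.nontrivial_of_finrank_pos (R := ℝ)
    rw [hd]; omega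
  -- two-dimensional function
  set R : ℝ × ℝ → ℝ := fun z => (Set.Ioi (0 : ℝ)).indicator
    (fun r => r ^ (n - 1) * (fb μ γ ((r - z.1) / 2) * fb μ γ ((r + z.1) / 2))) z.2 with hR
  have hRm : Measurable R := by
    have : R = (Prod.snd ⁻¹' Set.Ioi (0 : ℝ)).indicator (fun z : ℝ × ℝ => z.2 ^ (n - 1) *
        (fb μ γ ((z.2 - z.1) / 2) * fb μ γ ((z.2 + z.1) / 2))) := by
      funext z
      simp only [hR, Set.indicator, Set.mem_preimage]
    rw [this]
    refine Measurable.indicator ?_ (measurable_snd measurableSet_Ioi)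
    fun_prop
  have hRn : ∀ z, 0 ≤ R z := fun z => by
    refine Set.indicator_apply_nonneg fun h => ?_
    have hz2 : 0 < z.2 := h
    have := mul_nonneg (fb_nonneg μ γ ((z.2 - z.1) / 2)) (fb_nonneg μ γ ((z.2 + z.1) / 2))
    positivity
  have hRi : Integrable R (volume.prod volume) := by
    refine (integrable_fb2 hμ hβ).mono' hRm.aestronglyMeasurable
      (Filter.Eventually.of_forall fun z => ?_)
    rw [Real.norm_of_nonneg (hRn z)]
    by_cases hz : 0 < z.2
    · simp only [hR]
      rw [Set.indicator_of_mem (show z.2 ∈ Set.Ioi (0 : ℝ) from hz)]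
      exact fb_radial hn μ β z.1 z.2 hz
    · simp only [hR]
      rw [Set.indicator_of_notMem (show z.2 ∉ Set.Ioi (0 : ℝ) from hz)]
      exact mul_nonneg (fb_nonneg _ _ _) (fb_nonneg _ _ _)
  have hgm : Measurable (fun q : Spacetime n => fb μ γ (-uu q) * fb μ γ (vv q)) := by
    unfold uu vv
    fun_prop
  have e0 : ∀ (t : ℝ) (x : EuclideanSpace ℝ (Fin n)),
      fb μ γ (-uu (t, x)) * fb μ γ (vv (t, x))
        = (fun r => fb μ γ ((r - t) / 2) * fb μ γ ((r + t) / 2)) ‖x‖ := by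
    intro t x
    simp only [uu, vv]
    congr 2 <;> ring
  rw [show (volume : Measure (Spacetime n)) = volume.prod volume from rfl]
  rw [integrable_prod_iff hgm.aestronglyMeasurable]
  constructor
  · filter_upwards [hRi.prod_right_ae] with t ht
    simp only [e0]
    refine (integrable_fun_norm_addHaar (volume : Measure (EuclideanSpace ℝ (Fin n)))
      (f := fun r => fb μ γ ((r - t) / 2) * fb μ γ ((r + t) / 2))).2 ?_
    rw [hd]
    exact (integrable_indicator_iff measurableSet_Ioi).1 ht
  · have hI := hRi.integral_prod_left
    have e1 : ∀ t : ℝ, ∫ x : EuclideanSpace ℝ (Fin n), ‖fb μ γ (-uu (t, x)) * fb μ γ (vv (t, x))‖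
        = (n • (volume : Measure (EuclideanSpace ℝ (Fin n))).real (Metric.ball 0 1)) *
          ∫ r, R (t, r) := by
      intro t
      have : ∀ x : EuclideanSpace ℝ (Fin n), ‖fb μ γ (-uu (t, x)) * fb μ γ (vv (t, x))‖
          = (fun r => fb μ γ ((r - t) / 2) * fb μ γ ((r + t) / 2)) ‖x‖ := by
        intro x
        rw [Real.norm_of_nonneg (mul_nonneg (fb_nonneg _ _ _) (fb_nonneg _ _ _)), e0]
      simp only [this]
      rw [integral_fun_norm_addHaar (volume : Measure (EuclideanSpace ℝ (Fin n)))
        (fun r => fb μ γ ((r - t) / 2) * fb μ γ ((r + t) / 2)), hd]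
      simp only [hR, smul_eq_mul, nsmul_eq_mul]
      rw [integral_indicator measurableSet_Ioi]
      ring
    simp only [e1]
    exact hI.const_mul _

/-! ### Cutting off to a compact set -/

/-- The compact box in null coordinates. -/
def ZN (n : ℕ) (N : ℝ) : Set (Spacetime n) :=
  {q | Real.exp (-(2 * N)) ≤ vv q ∧ vv q ≤ Real.exp (2 * N) ∧
    Real.exp (-(2 * N)) ≤ -uu q ∧ -uu q ≤ Real.exp (2 * N)}

theorem continuous_uu (n : ℕ) : Continuous (uu : Spacetime n → ℝ) := by
  unfold uu; fun_prop

theorem continuous_vv (n : ℕ) : Continuous (vv : Spacetime n → ℝ) := by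
  unfold vv; fun_prop

theorem isClosed_ZN (n : ℕ) (N : ℝ) : IsClosed (ZN n N) := by
  have h1 := continuous_uu n
  have h2 := continuous_vv n
  unfold ZN
  refine (isClosed_le continuous_const h2).inter ((isClosed_le h2 continuous_const).inter
    ((isClosed_le continuous_const h1.neg).inter (isClosed_le h1.neg continuous_const)))

theorem isCompact_ZN (n : ℕ) (N : ℝ) : IsCompact (ZN n N) := by
  refine Metric.isCompact_of_isClosed_isBounded (isClosed_ZN n N) ?_
  refine (Metric.isBounded_closedBall (x := (0 : Spacetime n))
    (r := 2 * Real.exp (2 * N))).subset ?_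
  rintro q ⟨h1, h2, h3, h4⟩
  rw [mem_closedBall_zero_iff, Prod.norm_def]
  have e := Real.exp_pos (-(2 * N))
  unfold uu vv at *
  refine max_le ?_ ?_
  · rw [Real.norm_eq_abs, abs_le]; constructor <;> linarith
  · linarith

theorem ZN_subset (n : ℕ) (N : ℝ) : ZN n N ⊆ Dom n := by
  rintro q ⟨h1, h2, h3, h4⟩
  have e := Real.exp_pos (-(2 * N))
  show |q.1| < ‖q.2‖
  unfold uu vv at *
  rw [abs_lt]; constructor <;> linarith

theorem kap_zero_off {n : ℕ} {N : ℝ} (hN : 0 < N) {q : Spacetime n} (hq : q ∈ Dom n)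
    (hz : q ∉ ZN n N) : kap (ls q / N) = 0 ∨ kap (lt q / N) = 0 := by
  by_contra hcon
  push Not at hcon
  apply hz
  have h1 : |ls q / N| < 1 := by
    by_contra h; exact hcon.1 (kap_eq_zero (not_lt.1 h))
  have h2 : |lt q / N| < 1 := by
    by_contra h; exact hcon.2 (kap_eq_zero (not_lt.1 h))
  rw [abs_lt, lt_div_iff₀ hN, div_lt_iff₀ hN] at h1 h2
  have hv := vv_pos hq
  have hu := uu_neg hq
  unfold ls at h1
  unfold lt at h2
  refine ⟨?_, ?_, ?_, ?_⟩
  · rw [← Real.le_log_iff_exp_le hv]; linarith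
  · rw [← Real.log_le_iff_le_exp hv]; linarith
  · rw [← Real.le_log_iff_exp_le hu]; linarith
  · rw [← Real.log_le_iff_le_exp hu]; linarith

theorem indicator_zero_off {n : ℕ} {N : ℝ} {f : Spacetime n → ℝ}
    (h0 : ∀ q ∈ Dom n, q ∉ ZN n N → f q = 0) {q : Spacetime n} (hq : q ∉ ZN n N) :
    (Dom n).indicator f q = 0 :=
  Set.indicator_apply_eq_zero.2 fun h => h0 q h hq

theorem hasCompactSupport_ext {n : ℕ} {N : ℝ} {f : Spacetime n → ℝ}
    (h0 : ∀ q ∈ Dom n, q ∉ ZN n N → f q = 0) : HasCompactSupport ((Dom n).indicator f) :=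
  HasCompactSupport.intro (isCompact_ZN n N) fun _ hq => indicator_zero_off h0 hq

theorem ext_eventually_in {n : ℕ} (f : Spacetime n → ℝ) {q : Spacetime n} (hq : q ∈ Dom n) :
    (Dom n).indicator f =ᶠ[nhds q] f := by
  filter_upwards [(isOpen_Dom n).mem_nhds hq] with z hz
  rw [Set.indicator_of_mem hz]

theorem ext_eventually_out {n : ℕ} {N : ℝ} {f : Spacetime n → ℝ}
    (h0 : ∀ q ∈ Dom n, q ∉ ZN n N → f q = 0) {q : Spacetime n} (hq : q ∉ Dom n) :
    (Dom n).indicator f =ᶠ[nhds q] fun _ => 0 := by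
  have : q ∈ (ZN n N)ᶜ := fun h => hq (ZN_subset n N h)
  filter_upwards [(isClosed_ZN n N).isOpen_compl.mem_nhds this] with z hz
  exact indicator_zero_off h0 hz

theorem contDiff_ext {n : ℕ} {N : ℝ} {f : Spacetime n → ℝ}
    (h0 : ∀ q ∈ Dom n, q ∉ ZN n N → f q = 0) (hf : ∀ q ∈ Dom n, ContDiffAt ℝ 1 f q) :
    ContDiff ℝ 1 ((Dom n).indicator f) := by
  rw [contDiff_iff_contDiffAt]
  intro q
  by_cases hq : q ∈ Dom n
  · exact (hf q hq).congr_of_eventuallyEq (ext_eventually_in f hq)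
  · exact contDiffAt_const.congr_of_eventuallyEq (ext_eventually_out h0 hq)

theorem continuous_ext {n : ℕ} {N : ℝ} {f : Spacetime n → ℝ}
    (h0 : ∀ q ∈ Dom n, q ∉ ZN n N → f q = 0) (hf : ∀ q ∈ Dom n, ContinuousAt f q) :
    Continuous ((Dom n).indicator f) := by
  rw [continuous_iff_continuousAt]
  intro q
  by_cases hq : q ∈ Dom n
  · exact (hf q hq).congr (ext_eventually_in f hq).symm
  · exact continuousAt_const.congr (ext_eventually_out h0 hq).symm

theorem integrable_pd_ext {n : ℕ} {g : Spacetime n → ℝ} (hg : ContDiff ℝ 1 g)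
    (hc : HasCompactSupport g) (m : Option (Fin n)) : Integrable (pd m g) := by
  have h1 : Continuous (pd m g) := (hg.continuous_fderiv (by norm_num)).clm_apply continuous_const
  refine h1.integrable_of_hasCompactSupport ?_
  exact hc.fderiv_apply (𝕜 := ℝ) (ev m)

theorem integral_pd_ext {n : ℕ} {g : Spacetime n → ℝ} (hg : ContDiff ℝ 1 g)
    (hc : HasCompactSupport g) (m : Option (Fin n)) : ∫ q, pd m g q = 0 := by
  have hi := integrable_pd_ext hg hc m
  have hgi : Integrable g := hg.continuous.integrable_of_hasCompactSupport hc
  have hH : (volume : Measure (Spacetime n)).IsAddHaarMeasure :=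
    Measure.prod.instIsAddHaarMeasure volume volume
  have := integral_mul_fderiv_eq_neg_fderiv_mul_of_integrable (𝕜 := ℝ)
    (μ := (volume : Measure (Spacetime n)))
    (f := fun _ : Spacetime n => (1 : ℝ)) (g := g) (v := ev m) (by simp)
    (by simp only [one_mul]; exact hi) (by simpa using hgi) (fun x _ => by fun_prop)
    (fun x _ => (hg.differentiable (by norm_num)) x)
  simp only [one_mul] at this
  refine Eq.trans this ?_
  simp

/-! ### Pointwise inequalities -/

theorem absorb {p m Y h χ f G b : ℝ} (hp : 0 < p) (hm : 0 < m) (hmp : m ≤ p) (hY0 : 0 ≤ Y)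
    (hY1 : Y ≤ 1) (hh : 3 / 4 * p ≤ h) (hG : m * p ^ 2 * Y / 32 ≤ G)
    (hb : |b| ≤ 1 / 4 * p * m * Y * |f|) :
    m * p ^ 2 * Y / 48 * f ^ 2 ≤ 2 * h * χ ^ 2 + G * f ^ 2 + χ * b := by
  have h1 : b ^ 2 ≤ (1 / 4 * p * m * Y) ^ 2 * f ^ 2 := by
    rw [← sq_abs b, ← sq_abs f, ← mul_pow]
    gcongr
  have h2 : (1 / 4 * p * m * Y) ^ 2 * f ^ 2 ≤ 1 / 16 * p ^ 3 * m * Y * f ^ 2 := by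
    have : m * Y ≤ p := by nlinarith
    have h3 : 0 ≤ 1 / 16 * p ^ 2 * (m * Y) * f ^ 2 := by positivity
    nlinarith [mul_nonneg h3 (sub_nonneg.2 this)]
  have h4 : -(1 / 96 * p ^ 2 * m * Y * f ^ 2) ≤ 3 / 2 * p * χ ^ 2 + χ * b := by
    have h5 : 0 ≤ (3 * p * χ + b) ^ 2 := sq_nonneg _
    have h6 : 0 ≤ 6 * p * (3 / 2 * p * χ ^ 2 + χ * b + 1 / 96 * p ^ 2 * m * Y * f ^ 2) := by
      nlinarith
    have := nonneg_of_mul_nonneg_right h6 (by positivity : 0 < 6 * p)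
    linarith
  have h7 : 3 / 2 * p * χ ^ 2 ≤ 2 * h * χ ^ 2 := by nlinarith [sq_nonneg χ]
  have h8 : m * p ^ 2 * Y / 32 * f ^ 2 ≤ G * f ^ 2 := by gcongr
  nlinarith

theorem boundary {ε W M h g h1 K H Kd Hd S T f A p : ℝ} (hε : 0 ≤ ε) (hW : 0 ≤ W)
    (hM : 0 ≤ M) (hK0 : 0 ≤ K) (hK1 : K ≤ 1) (hH0 : 0 ≤ H) (hH1 : H ≤ 1)
    (hKd : |Kd| ≤ ε) (hHd : |Hd| ≤ ε) (hS : |S| ≤ W) (hT : |T| ≤ W) (hf : |f| ≤ W)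
    (hg : |g| ≤ M) (hh : |h| ≤ M) (hh1 : |h1| ≤ p ^ 2) (hA : Kd * A ≤ ε * W ^ 2) :
    -(ε * (2 * (1 + M) + 2 + M ^ 2 + p ^ 2) * W ^ 2) ≤
      (S + g * f) * (Kd * H * S - K * Hd * T)
        - 1 / 2 * (Kd * H) * (S ^ 2 - T ^ 2 + A)
        + 1 / 2 * (2 * h * g - h1) * f ^ 2 * (Kd * H) := by
  have hKH : |Kd * H| ≤ ε := by
    rw [abs_mul, abs_of_nonneg hH0]
    exact (mul_le_of_le_one_right (abs_nonneg _) hH1).trans hKd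
  have hHK : |K * Hd| ≤ ε := by
    rw [abs_mul, abs_of_nonneg hK0]
    exact (mul_le_of_le_one_left (abs_nonneg _) hK1).trans hHd
  have hS2 : S ^ 2 ≤ W ^ 2 := by rw [← sq_abs]; gcongr
  have hT2 : T ^ 2 ≤ W ^ 2 := by rw [← sq_abs]; gcongr
  have hf2 : f ^ 2 ≤ W ^ 2 := by rw [← sq_abs]; gcongr
  have b1 : |(S + g * f) * (Kd * H * S - K * Hd * T)| ≤ (W + M * W) * (ε * W + ε * W) := by
    rw [abs_mul]
    have i1 : |S + g * f| ≤ W + M * W := by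
      refine (abs_add_le _ _).trans ?_
      rw [abs_mul]; gcongr
    have i2 : |Kd * H * S - K * Hd * T| ≤ ε * W + ε * W := by
      refine (abs_sub _ _).trans ?_
      rw [abs_mul, abs_mul (K * Hd)]; gcongr
    gcongr
  have b2 : |Kd * H * (S ^ 2 - T ^ 2)| ≤ ε * W ^ 2 := by
    rw [abs_mul]
    have : |S ^ 2 - T ^ 2| ≤ W ^ 2 := by
      rw [abs_le]; constructor <;> nlinarith [sq_nonneg S, sq_nonneg T]
    gcongr
  have b3 : Kd * H * A ≤ ε * W ^ 2 := by
    have : Kd * H * A = H * (Kd * A) := by ring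
    rw [this]
    have h0 : 0 ≤ ε * W ^ 2 := by positivity
    nlinarith
  have b4 : |(2 * h * g - h1) * f ^ 2 * (Kd * H)| ≤ (2 * M * M + p ^ 2) * W ^ 2 * ε := by
    rw [abs_mul, abs_mul, abs_of_nonneg (sq_nonneg f)]
    have : |2 * h * g - h1| ≤ 2 * M * M + p ^ 2 := by
      refine (abs_sub _ _).trans ?_
      rw [abs_mul, abs_mul, abs_two]; gcongr
    gcongr
  have c1 := (abs_le.1 b1).1
  have c2 := (abs_le.1 b2).2
  have c4 := (abs_le.1 b4).1
  have hp : 0 ≤ ε * p ^ 2 * W ^ 2 := by positivity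
  have hw : 0 ≤ ε * W ^ 2 := by positivity
  nlinarith

theorem dominate {n : ℕ} {q : Spacetime n} (hq : q ∈ Dom n) (μ γ : ℝ) :
    Real.exp (2 * ls q * μ) / yy q *
      (((1 + |uu q|) * (1 + |vv q|)) ^ (γ / 2))⁻¹ ^ 2
      = fb μ γ (-uu q) * fb μ γ (vv q) / 4 := by
  have hv := vv_pos hq
  have hu := uu_neg hq
  have hu1 : |uu q| = -uu q := abs_of_neg (by linarith)
  rw [Real.exp_mul, exp_ls hq, yy_eq, hu1, abs_of_pos hv]
  unfold fb
  rw [if_pos hu, if_pos hv]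
  generalize -uu q = a at *
  generalize vv q = b at *
  have h1 : (((1 + a) * (1 + b)) ^ (γ / 2))⁻¹ ^ 2 = (1 + a) ^ (-γ) * (1 + b) ^ (-γ) := by
    rw [← Real.mul_rpow (by linarith) (by linarith), ← Real.rpow_neg (by positivity),
      ← Real.rpow_natCast, ← Real.rpow_mul (by positivity)]
    congr 1
    push_cast; ring
  rw [h1, Real.mul_rpow hv.le hu.le, Real.rpow_sub_one hu.ne', Real.rpow_sub_one hv.ne']
  field_simp

/-! ### The main argument -/

/-- The weight appearing in the decay condition. -/
def Pw {n : ℕ} (γ : ℝ) (q : Spacetime n) : ℝ := ((1 + |uu q|) * (1 + |vv q|)) ^ (γ / 2)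

theorem Pw_pos {n : ℕ} (γ : ℝ) (q : Spacetime n) : 0 < Pw γ q := by
  unfold Pw; positivity

theorem dec_bounds {n : ℕ} {β : ℝ} {φ : Spacetime n → ℝ} (hdec : Dec β φ) :
    ∃ C : ℝ, 0 ≤ C ∧ ∀ q ∈ Dom n,
      |Sf φ q| ≤ C * (Pw ((n : ℝ) - 1 + β) q)⁻¹ ∧ |Tf φ q| ≤ C * (Pw ((n : ℝ) - 1 + β) q)⁻¹ ∧
      |φ q| ≤ C * (Pw ((n : ℝ) - 1 + β) q)⁻¹ ∧
      (ls q < 0 → yy q * angSq φ q ≤ (C * (Pw ((n : ℝ) - 1 + β) q)⁻¹) ^ 2) := by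
  obtain ⟨⟨C1, h1⟩, ⟨C2, h2⟩, ⟨C3, h3⟩⟩ := hdec
  refine ⟨2 * (|C1| + |C2| + |C3|), by positivity, fun q hq => ?_⟩
  set C := 2 * (|C1| + |C2| + |C3|) with hC
  have hP := Pw_pos ((n : ℝ) - 1 + β) q
  set P := Pw ((n : ℝ) - 1 + β) q with hPd
  have key : ∀ X c : ℝ, P * X ≤ c → |c| ≤ C → X ≤ C * P⁻¹ := by
    intro X c hx hc
    rw [← div_eq_mul_inv, le_div_iff₀ hP]
    nlinarith [le_abs_self c]
  have n1 := abs_nonneg C1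
  have n2 := abs_nonneg C2
  have n3 := abs_nonneg C3
  have k1 := key _ C1 (h1 q hq) (by linarith)
  refine ⟨?_, ?_, key _ C3 (h3 q hq) (by linarith), fun hs => ?_⟩
  · rw [Sf_uv hq]
    exact (abs_add_le _ _).trans k1
  · rw [Tf_uv]
    refine (abs_sub _ _).trans ?_
    linarith
  · have huv : |uu q * vv q| < 1 := by
      rw [abs_uv hq]
      rw [← Real.exp_zero]
      exact Real.exp_lt_exp.2 (by linarith)
    have h4 := h2 q hq huv
    have k2 := key (2 * (|uu q * vv q| ^ ((1 : ℝ) / 2) * Real.sqrt (angSq φ q))) (2 * C2)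
      (by
        have : P * (|uu q * vv q| ^ ((1 : ℝ) / 2) * Real.sqrt (angSq φ q)) ≤ C2 := by
          rw [← mul_assoc]; exact h4
        linarith)
      (by rw [abs_mul, abs_two]; linarith)
    have e : yy q * angSq φ q
        = (2 * (|uu q * vv q| ^ ((1 : ℝ) / 2) * Real.sqrt (angSq φ q))) ^ 2 := by
      rw [mul_pow, mul_pow, Real.sq_sqrt (angSq_nonneg hq φ), ← Real.sqrt_eq_rpow,
        Real.sq_sqrt (abs_nonneg _), abs_uv hq, yy_exp hq]
      ring
    rw [e]
    gcongr

theorem hasDerivAt_kap_div (N s : ℝ) :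
    HasDerivAt (fun s => kap (s / N)) (kapd (s / N) / N) s := by
  have := (hasDerivAt_kap (s / N)).comp s ((hasDerivAt_id s).div_const N)
  refine HasDerivAt.congr_deriv this ?_
  ring

theorem contDiff_kap_div (N : ℝ) : ContDiff ℝ 1 (fun s => kap (s / N)) :=
  contDiff_kap.comp (contDiff_id.div_const N)

theorem core {n : ℕ} (hn : 2 ≤ n) {β p : ℝ} (hp : 0 < p) (hpβ : p < β)
    {φ : Spacetime n → ℝ} (hφ : ContDiffOn ℝ 2 φ (Dom n))
    (hbox : ∀ q ∈ Dom n, |yy q * box φ q| ≤ 1 / 4 * p * min (β - p) p *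
      min (Real.exp (p * ls q)) (Real.exp (-(p * ls q))) * |φ q|)
    (hdec : Dec β φ) : ∀ q ∈ Dom n, φ q = 0 := by
  intro q0 hq0
  by_contra hne
  set m := min (β - p) p with hm
  have hm0 : 0 < m := lt_min (by linarith) hp
  have hmp : m ≤ p := min_le_right _ _
  have hmβ : m ≤ β - p := min_le_left _ _
  set c : ℝ := ((n : ℝ) - 1) / 2 with hc
  have hc0 : 0 ≤ c := by
    have : (2 : ℝ) ≤ n := by exact_mod_cast hn
    rw [hc]; linarith
  obtain ⟨F, h, h1, h2, hF, hh, hh1, cF, ch, ch1, hlo, hhi, hh1b, hG, CF, hCF0, hCF⟩ :=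
    exists_weight p (m / 4) hp (by positivity) (by linarith)
  obtain ⟨C, hC0, hCb⟩ := dec_bounds hdec
  set γ : ℝ := (n : ℝ) - 1 + β with hγ
  have hφa : ∀ q ∈ Dom n, ContDiffAt ℝ 2 φ q := fun q hq =>
    hφ.contDiffAt ((isOpen_Dom n).mem_nhds hq)
  set Gd : ℝ → Spacetime n → ℝ := fun μ q => fb μ γ (-uu q) * fb μ γ (vv q) with hGd
  have hGd0 : ∀ μ q, 0 ≤ Gd μ q := fun μ q => mul_nonneg (fb_nonneg _ _ _) (fb_nonneg _ _ _)
  set Ψ : Spacetime n → ℝ := fun q => Gd (p - m / 4) q + Gd (p + m / 4) q with hΨ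
  have hΨi : Integrable Ψ :=
    (integrable_Gd (by omega) (by linarith) (by linarith)).add
      (integrable_Gd (by omega) (by linarith) (by linarith))
  have hΨ0 : ∀ q, 0 ≤ Ψ q := fun q => add_nonneg (hGd0 _ _) (hGd0 _ _)
  set Y : ℝ → ℝ := fun s => min (Real.exp (p * s)) (Real.exp (-(p * s))) with hY
  have hY0 : ∀ s, 0 < Y s := fun s => lt_min (Real.exp_pos _) (Real.exp_pos _)
  have hY1 : ∀ s, Y s ≤ 1 := fun s => by
    rcases le_total (p * s) 0 with h | h
    · exact (min_le_left _ _).trans (Real.exp_le_one_iff.2 h)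
    · exact (min_le_right _ _).trans (Real.exp_le_one_iff.2 (by linarith))
  -- the density
  set d0 : Spacetime n → ℝ := fun q =>
    Real.exp (2 * F (ls q)) / yy q * (m * p ^ 2 * Y (ls q) / 48 * φ q ^ 2) with hd0
  have hd0n : ∀ q ∈ Dom n, 0 ≤ d0 q := fun q hq => by
    have := yy_pos hq
    have := hY0 (ls q)
    simp only [hd0]; positivity
  set dN : ℝ → Spacetime n → ℝ := fun N q => kap (ls q / N) * kap (lt q / N) * d0 q with hdN
  have dN_zero : ∀ N, 0 < N → ∀ q ∈ Dom n, q ∉ ZN n N → dN N q = 0 := by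
    intro N hN q hq hz
    simp only [hdN]
    rcases kap_zero_off hN hq hz with h | h <;> simp [h]
  have dN_cont : ∀ N, ∀ q ∈ Dom n, ContinuousAt (dN N) q := by
    intro N q hq
    have e1 : ContinuousAt (ls : Spacetime n → ℝ) q := (contDiffAt_ls hq (k := 1)).continuousAt
    have e2 : ContinuousAt (lt : Spacetime n → ℝ) q := (contDiffAt_lt hq (k := 1)).continuousAt
    have e3 : ContinuousAt φ q := (hφa q hq).continuousAt
    have e4 : ContinuousAt (yy : Spacetime n → ℝ) q := by unfold yy; fun_prop
    have k1 : ContinuousAt (fun q : Spacetime n => kap (ls q / N)) q :=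
      (contDiff_kap_div N).continuous.continuousAt.comp e1
    have k2 : ContinuousAt (fun q : Spacetime n => kap (lt q / N)) q :=
      (contDiff_kap_div N).continuous.continuousAt.comp e2
    have k3 : ContinuousAt (fun q : Spacetime n => F (ls q)) q :=
      cF.continuous.continuousAt.comp e1
    have cY : Continuous Y := by simp only [hY]; fun_prop
    have k4 : ContinuousAt (fun q : Spacetime n => Y (ls q)) q := cY.continuousAt.comp e1
    have k5 : ContinuousAt (fun q : Spacetime n => Real.exp (2 * F (ls q))) q :=
      Real.continuous_exp.continuousAt.comp (k3.const_mul 2)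
    exact (k1.mul k2).mul ((k5.div e4 (yy_pos hq).ne').mul
      ((((continuousAt_const.mul k4).div_const 48)).mul (e3.pow 2)))
  have dN_C : ∀ N, 0 < N → Continuous ((Dom n).indicator (dN N)) := fun N hN =>
    continuous_ext (dN_zero N hN) (dN_cont N)
  have dN_S : ∀ N, 0 < N → HasCompactSupport ((Dom n).indicator (dN N)) := fun N hN =>
    hasCompactSupport_ext (dN_zero N hN)
  have dN_I : ∀ N, 0 < N → Integrable ((Dom n).indicator (dN N)) := fun N hN =>
    (dN_C N hN).integrable_of_hasCompactSupport (dN_S N hN)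
  have dN_n : ∀ N q, 0 ≤ (Dom n).indicator (dN N) q := fun N q =>
    Set.indicator_apply_nonneg fun hq =>
      mul_nonneg (mul_nonneg (kap_nonneg _) (kap_nonneg _)) (hd0n q hq)
  -- the main inequality
  set M : ℝ := c + (p + m / 4) with hM
  set C1 : ℝ := 4 * (2 * (1 + M) + 2 + M ^ 2 + p ^ 2) * C ^ 2 * (CF / 4) with hC1
  have hM0 : 0 ≤ M := by rw [hM]; positivity
  have main : ∀ N : ℝ, 0 < N → ∫ q, (Dom n).indicator (dN N) q ≤ C1 / N * ∫ q, Ψ q := by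
    intro N hN
    set K : ℝ → ℝ := fun s => kap (s / N) with hK
    set J : Option (Fin n) → Spacetime n → ℝ := fun l =>
      Jf (fun x => Aw K F (ls x) * K (lt x)) (fun x => c + h (ls x))
        (fun x => Ew K F h h1 c (ls x) * K (lt x)) φ l with hJ
    have J_zero : ∀ l, ∀ q ∈ Dom n, q ∉ ZN n N → J l q = 0 := by
      intro l q hq hz
      simp only [hJ, Jf, Aw, Ew, hK]
      rcases kap_zero_off hN hq hz with h | h <;> simp [h]
    have J_cd : ∀ l, ∀ q ∈ Dom n, ContDiffAt ℝ 1 (J l) q := by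
      intro l q hq
      have cK : ContDiff ℝ 1 K := contDiff_kap_div N
      have cA : ContDiff ℝ 1 (Aw K F) := by
        unfold Aw; fun_prop
      have cE : ContDiff ℝ 1 (Ew K F h h1 c) := by
        unfold Ew; fun_prop
      have e1 := contDiffAt_ls hq (k := 1)
      have e2 := contDiffAt_lt hq (k := 1)
      have a1 : ContDiffAt ℝ 1 (fun x : Spacetime n => Aw K F (ls x)) q :=
        cA.contDiffAt.comp q e1
      have a2 : ContDiffAt ℝ 1 (fun x : Spacetime n => Ew K F h h1 c (ls x)) q :=
        cE.contDiffAt.comp q e1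
      have a3 : ContDiffAt ℝ 1 (fun x : Spacetime n => K (lt x)) q :=
        cK.contDiffAt.comp q e2
      have a4 : ContDiffAt ℝ 1 (fun x : Spacetime n => h (ls x)) q :=
        ch.contDiffAt.comp q e1
      exact contDiffAt_Jf (hφa q hq) (a1.mul a3) (contDiffAt_const.add a4) (a2.mul a3) l
    have J_C : ∀ l, ContDiff ℝ 1 ((Dom n).indicator (J l)) := fun l =>
      contDiff_ext (J_zero l) (J_cd l)
    have J_S : ∀ l, HasCompactSupport ((Dom n).indicator (J l)) := fun l =>
      hasCompactSupport_ext (J_zero l)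
    have hsum : ∫ q, ∑ l, pd l ((Dom n).indicator (J l)) q = 0 := by
      rw [integral_finsetSum _ fun l _ => integrable_pd_ext (J_C l) (J_S l) l]
      exact Finset.sum_eq_zero fun l _ => integral_pd_ext (J_C l) (J_S l) l
    have hsumI : Integrable fun q => ∑ l, pd l ((Dom n).indicator (J l)) q :=
      integrable_finsetSum _ fun l _ => integrable_pd_ext (J_C l) (J_S l) l
    have hC1N : 0 ≤ C1 / N := by rw [hC1]; positivity
    have pt : ∀ q, (Dom n).indicator (dN N) q ≤
        ∑ l, pd l ((Dom n).indicator (J l)) q + C1 / N * Ψ q := by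
      intro q
      by_cases hq : q ∈ Dom n
      · have e1 : ∑ l, pd l ((Dom n).indicator (J l)) q = ∑ l, pd l (J l) q := by
          refine Finset.sum_congr rfl fun l _ => ?_
          unfold pd
          rw [(ext_eventually_in (J l) hq).fderiv_eq]
        rw [Set.indicator_of_mem hq, e1]
        simp only [hJ]
        rw [weighted_identity hq (hφa q hq) (hasDerivAt_kap_div N (ls q))
          (hasDerivAt_kap_div N (lt q)) (hF _) (hh _) (hh1 _) c hc]
        obtain ⟨bS, bT, bφ, bA⟩ := hCb q hq
        set W := C * (Pw γ q)⁻¹ with hW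
        have hPi := inv_pos.2 (Pw_pos γ q)
        have hW0 : 0 ≤ W := by rw [hW]; positivity
        have hy := yy_pos hq
        have hhlo := hlo (ls q)
        have hhhi := hhi (ls q)
        have hh0 : 0 ≤ h (ls q) := by linarith
        have hKd : ∀ x, |kapd x / N| ≤ 4 / N := fun x => by
          rw [abs_div, abs_of_pos hN]
          have := kapd_abs_le x
          gcongr
        have hA0 : 0 ≤ yy q * angSq φ q := mul_nonneg hy.le (angSq_nonneg hq φ)
        have hKA : kapd (ls q / N) / N * (yy q * angSq φ q) ≤ 4 / N * W ^ 2 := by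
          rcases le_or_gt 0 (ls q) with hs | hs
          · have h1 : kapd (ls q / N) / N ≤ 0 :=
              div_nonpos_of_nonpos_of_nonneg (kapd_nonpos (by positivity)) hN.le
            have h2 : 0 ≤ 4 / N * W ^ 2 := by positivity
            nlinarith
          · have h1 := (le_abs_self _).trans (hKd (ls q / N))
            have h2 := bA hs
            calc _ ≤ 4 / N * (yy q * angSq φ q) := by gcongr
              _ ≤ _ := by gcongr
        have B1 := absorb (χ := Sf φ q + (c + h (ls q)) * φ q) hp hm0 hmp (hY0 (ls q)).le
          (hY1 (ls q)) (h := h (ls q)) (by linarith)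
          (G := h (ls q) * h1 (ls q) - h2 (ls q) / 2)
          (le_trans (le_of_eq (by ring)) (hG (ls q))) (hbox q hq)
        have B2 := boundary (ε := 4 / N) (W := W) (M := M) (h := h (ls q)) (g := c + h (ls q))
          (h1 := h1 (ls q)) (p := p) (by positivity) hW0 hM0 (kap_nonneg (ls q / N))
          (kap_le_one (ls q / N)) (kap_nonneg (lt q / N)) (kap_le_one (lt q / N))
          (hKd (ls q / N)) (hKd (lt q / N)) bS bT bφ
          (by rw [abs_of_nonneg (by positivity)]; linarith)
          (by rw [abs_of_nonneg hh0]; linarith) (hh1b (ls q)) hKA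
        have B3 : Real.exp (2 * F (ls q)) / yy q * W ^ 2 ≤ C ^ 2 * (CF / 4) * Ψ q := by
          have d1 := dominate hq (p - m / 4) γ
          have d2 := dominate hq (p + m / 4) γ
          calc Real.exp (2 * F (ls q)) / yy q * W ^ 2
              ≤ CF * (Real.exp (2 * ls q * (p - m / 4)) + Real.exp (2 * ls q * (p + m / 4)))
                / yy q * W ^ 2 := by
                have := hCF (ls q)
                gcongr
            _ = C ^ 2 * CF * (Real.exp (2 * ls q * (p - m / 4)) / yy q * (Pw γ q)⁻¹ ^ 2
                + Real.exp (2 * ls q * (p + m / 4)) / yy q * (Pw γ q)⁻¹ ^ 2) := by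
                rw [hW]; ring
            _ = C ^ 2 * (CF / 4) * Ψ q := by
                unfold Pw
                rw [d1, d2]
                simp only [hΨ, hGd]; ring
        have hE : 0 ≤ Real.exp (2 * F (ls q)) / yy q := by positivity
        have hKK : 0 ≤ kap (ls q / N) * kap (lt q / N) :=
          mul_nonneg (kap_nonneg _) (kap_nonneg _)
        have B4 := mul_le_mul_of_nonneg_left (add_le_add
          (mul_le_mul_of_nonneg_left B1 hKK) B2) hE
        have B5 : 4 / N * (2 * (1 + M) + 2 + M ^ 2 + p ^ 2) *
            (Real.exp (2 * F (ls q)) / yy q * W ^ 2) ≤ C1 / N * Ψ q := by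
          refine (mul_le_mul_of_nonneg_left B3 (by positivity)).trans (le_of_eq ?_)
          rw [hC1]; ring
        have B6 : dN N q = Real.exp (2 * F (ls q)) / yy q * (kap (ls q / N) * kap (lt q / N) *
            (m * p ^ 2 * Y (ls q) / 48 * φ q ^ 2)) := by
          simp only [hdN, hd0]; ring
        rw [B6]
        refine le_trans ?_ (add_le_add B4 B5)
        apply le_of_eq
        ring
      · have e1 : ∑ l, pd l ((Dom n).indicator (J l)) q = 0 := by
          refine Finset.sum_eq_zero fun l _ => ?_
          unfold pd
          rw [(ext_eventually_out (J_zero l) hq).fderiv_eq]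
          simp
        rw [e1, Set.indicator_of_notMem hq, zero_add]
        exact mul_nonneg hC1N (hΨ0 q)
    calc ∫ q, (Dom n).indicator (dN N) q
        ≤ ∫ q, (∑ l, pd l ((Dom n).indicator (J l)) q + C1 / N * Ψ q) :=
          integral_mono (dN_I N hN) (hsumI.add (hΨi.const_mul _)) pt
      _ = C1 / N * ∫ q, Ψ q := by
          rw [integral_add hsumI (hΨi.const_mul _), hsum, integral_const_mul, zero_add]
  -- conclusion
  set N0 : ℝ := |ls q0| + |lt q0| + 1 with hN0
  have hN0p : 0 < N0 := by positivity
  have hle : ∀ N, N0 ≤ N → ∫ q, (Dom n).indicator (dN N0) q ≤ C1 / N * ∫ q, Ψ q := by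
    intro N hN
    have hNp : 0 < N := hN0p.trans_le hN
    refine le_trans (integral_mono (dN_I N0 hN0p) (dN_I N hNp) fun q => ?_) (main N hNp)
    refine Set.indicator_le_indicator' fun hq => ?_
    have := hd0n q hq
    have i1 := kap_mono (x := ls q) hN0p hN
    have i2 := kap_mono (x := lt q) hN0p hN
    have i3 := kap_nonneg (lt q / N0)
    have i4 := kap_nonneg (ls q / N)
    simp only [hdN]
    gcongr
  have hlim : Filter.Tendsto (fun N : ℝ => C1 / N * ∫ q, Ψ q) Filter.atTop (nhds 0) := by
    have := (Filter.Tendsto.div_atTop (tendsto_const_nhds (x := C1))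
      (Filter.tendsto_id (α := ℝ))).mul_const (∫ q, Ψ q)
    simpa using this
  have hle0 : ∫ q, (Dom n).indicator (dN N0) q ≤ 0 :=
    ge_of_tendsto hlim (Filter.eventually_atTop.2 ⟨N0, hle⟩)
  have hH : (volume : Measure (Spacetime n)).IsAddHaarMeasure :=
    Measure.prod.instIsAddHaarMeasure volume volume
  have hpos : 0 < ∫ q, (Dom n).indicator (dN N0) q := by
    refine (dN_C N0 hN0p).integral_pos_of_hasCompactSupport_nonneg_nonzero (dN_S N0 hN0p)
      (fun q => dN_n N0 q) (x := q0) ?_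
    rw [Set.indicator_of_mem hq0]
    have k1 : 0 < kap (ls q0 / N0) := kap_pos (by
      rw [abs_div, abs_of_pos hN0p, div_lt_one hN0p]
      linarith [abs_nonneg (lt q0)])
    have k2 : 0 < kap (lt q0 / N0) := kap_pos (by
      rw [abs_div, abs_of_pos hN0p, div_lt_one hN0p]
      linarith [abs_nonneg (ls q0)])
    have k3 := yy_pos hq0
    have k4 := hY0 (ls q0)
    simp only [hdN, hd0]
    positivity
  linarith

theorem uc_finite (n : ℕ) (hn : 2 ≤ n) :
    ∃ B : ℝ, 0 < B ∧
      ∀ (β p : ℝ), 0 < β → 0 < p → p < β →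
      ∀ (φ 𝒱 : Spacetime n → ℝ),
        ContDiffOn ℝ 2 φ (Dom n) →
        ContinuousOn 𝒱 (Dom n) →
        (∀ q ∈ Dom n, |box φ q| ≤ |𝒱 q| * |φ q|) →
        Dec β φ →
        (∀ q ∈ Dom n, |𝒱 q| ≤
            B * p * min (β - p) p *
              min (|uu q * vv q| ^ (-1 + p / 2)) (|uu q * vv q| ^ (-1 - p / 2))) →
        ∀ q ∈ Dom n, φ q = 0 := by
  refine ⟨1 / 16, by norm_num, ?_⟩
  intro β p _ hp hpβ φ V hφ _ hbox hdec hV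
  refine core hn hp hpβ hφ (fun q hq => ?_) hdec
  have h1 := hbox q hq
  have h2 := hV q hq
  have hy := yy_pos hq
  set m := min (β - p) p with hm
  have hexp : ∀ a : ℝ, yy q * |uu q * vv q| ^ a = 4 * Real.exp (2 * ls q * (1 + a)) := by
    intro a
    rw [abs_uv hq, ← Real.exp_mul, yy_exp hq, mul_assoc, ← Real.exp_add]
    congr 2; ring
  have hmin : yy q * min (|uu q * vv q| ^ (-1 + p / 2)) (|uu q * vv q| ^ (-1 - p / 2))
      = 4 * min (Real.exp (p * ls q)) (Real.exp (-(p * ls q))) := by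
    rw [mul_min_of_nonneg _ _ hy.le, mul_min_of_nonneg _ _ (by norm_num : (0 : ℝ) ≤ 4),
      hexp, hexp]
    congr 3 <;> ring
  rw [abs_mul, abs_of_pos hy]
  calc yy q * |box φ q| ≤ yy q * (|V q| * |φ q|) := by gcongr
    _ ≤ yy q * ((1 / 16 * p * m * min (|uu q * vv q| ^ (-1 + p / 2))
          (|uu q * vv q| ^ (-1 - p / 2))) * |φ q|) := by gcongr
    _ = 1 / 16 * p * m * (yy q * min (|uu q * vv q| ^ (-1 + p / 2))
          (|uu q * vv q| ^ (-1 - p / 2))) * |φ q| := by ring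
    _ = _ := by rw [hmin]; ring
end
end

section
/- For every n ≥ 2 and every k > 0, there exist R > 0, a function 𝒱 ∈ C^∞(ℝ^{1+n}) whose support is contained in {(t,x) : |x| ≤ R}, a function φ ∈ C^∞(ℝ^{1+n}), and a constant C > 0, such that □φ + 𝒱·φ = 0 everywhere on ℝ^{1+n}, |φ(t,x)| ≤ C·(1+|x|)^{−k} for all (t,x) ∈ ℝ^{1+n}, and φ is not identically zero on D. -/
open Real MeasureTheory
open scoped BigOperators

noncomputable section

namespace UCaux

open scoped ContDiff InnerProductSpace

/-- A smooth positive function equal to `s` for `s ≥ 1`. -/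
def mm (s : ℝ) : ℝ := (1 - Real.smoothTransition s) + s * Real.smoothTransition s

lemma mm_pos (s : ℝ) : 0 < mm s := by
  unfold mm
  rcases le_or_gt s 0 with h | h
  · simp [Real.smoothTransition.zero_of_nonpos h]
  · have h0 := Real.smoothTransition.pos_of_pos h
    have h1 := Real.smoothTransition.le_one s
    have := mul_pos h h0
    linarith

lemma mm_eq {s : ℝ} (h : 1 ≤ s) : mm s = s := by
  simp [mm, Real.smoothTransition.one_of_one_le h]

lemma mm_smooth : ContDiff ℝ ∞ mm := by
  have h : ContDiff ℝ ∞ Real.smoothTransition := Real.smoothTransition.contDiff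
  unfold mm
  fun_prop

def gg (a s : ℝ) : ℝ := mm s ^ (-a)

lemma gg_pos (a s : ℝ) : 0 < gg a s := Real.rpow_pos_of_pos (mm_pos s) _

lemma gg_smooth (a : ℝ) : ContDiff ℝ ∞ (gg a) :=
  mm_smooth.rpow_const_of_ne fun s => (mm_pos s).ne'

lemma gg_deriv_smooth (a : ℝ) : ContDiff ℝ ∞ (deriv (gg a)) :=
  (contDiff_infty_iff_deriv.1 (gg_smooth a)).2

lemma gg_deriv2_smooth (a : ℝ) : ContDiff ℝ ∞ (deriv (deriv (gg a))) :=
  (contDiff_infty_iff_deriv.1 (gg_deriv_smooth a)).2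

lemma gg_deriv {a s : ℝ} (h : 1 < s) : deriv (gg a) s = -a * s ^ (-a - 1) := by
  have : gg a =ᶠ[nhds s] fun s => s ^ (-a) := by
    filter_upwards [lt_mem_nhds h] with y hy
    simp [gg, mm_eq hy.le]
  rw [this.deriv_eq]
  exact (Real.hasDerivAt_rpow_const (Or.inl (by positivity))).deriv

lemma gg_deriv2 {a s : ℝ} (h : 1 < s) :
    deriv (deriv (gg a)) s = -a * ((-a - 1) * s ^ (-a - 1 - 1)) := by
  have : deriv (gg a) =ᶠ[nhds s] fun s => -a * s ^ (-a - 1) := by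
    filter_upwards [lt_mem_nhds h] with y hy
    exact gg_deriv hy
  rw [this.deriv_eq]
  exact ((Real.hasDerivAt_rpow_const (Or.inl (by positivity))).const_mul _).deriv

variable {n : ℕ}

def ZZ (c : Fin n → ℂ) : Spacetime n →L[ℝ] ℂ :=
  LinearMap.toContinuousLinearMap
    { toFun := fun p => ∑ i, c i * (p.2 i : ℂ)
      map_add' := by
        intro p q
        simp [mul_add, Finset.sum_add_distrib]
      map_smul' := by
        intro r p
        simp only [Prod.smul_snd, PiLp.smul_apply, smul_eq_mul, Complex.ofReal_mul,
          RingHom.id_apply, Complex.real_smul, Finset.mul_sum]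
        exact Finset.sum_congr rfl fun i _ => by ring }

lemma ZZ_apply (c : Fin n → ℂ) (p : Spacetime n) : ZZ c p = ∑ i, c i * (p.2 i : ℂ) := rfl

lemma ZZ_single (c : Fin n → ℂ) (i : Fin n) (t : ℝ) :
    ZZ c (t, EuclideanSpace.single i 1) = c i := by
  rw [ZZ_apply, Finset.sum_eq_single i]
  · simp
  · intro j _ hj
    simp [hj]
  · simp

lemma hasF_G {g : ℝ → ℝ} {p : Spacetime n} (hg : DifferentiableAt ℝ g (‖p.2‖ ^ 2)) :
    HasFDerivAt (fun p : Spacetime n => g (‖p.2‖ ^ 2))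
      ((deriv g (‖p.2‖ ^ 2)) • ((2 : ℝ) • (innerSL ℝ p.2).comp
        (ContinuousLinearMap.snd ℝ ℝ (EuclideanSpace ℝ (Fin n))))) p := by
  have h1 : HasFDerivAt (fun p : Spacetime n => ‖p.2‖ ^ 2) ((2 : ℝ) • (innerSL ℝ p.2).comp
        (ContinuousLinearMap.snd ℝ ℝ (EuclideanSpace ℝ (Fin n)))) p := by
    have := (hasFDerivAt_snd (𝕜 := ℝ) (p := p)).norm_sq
    refine this.congr_fderiv ?_
    ext <;> simp
  exact hg.hasDerivAt.comp_hasFDerivAt p h1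

lemma fd_G {g : ℝ → ℝ} {p : Spacetime n} (hg : Differentiable ℝ g) (v : Spacetime n) :
    fderiv ℝ (fun p : Spacetime n => g (‖p.2‖ ^ 2)) p v =
      deriv g (‖p.2‖ ^ 2) * (2 * ⟪p.2, v.2⟫_ℝ) := by
  rw [(hasF_G (hg _)).fderiv]; simp

lemma hasF_Y (c : Fin n → ℂ) (b : ℂ) (l : ℕ) (p : Spacetime n) :
    HasFDerivAt (fun p : Spacetime n => (b * ZZ c p ^ l).re)
      (Complex.reCLM.comp ((b * (l * ZZ c p ^ (l - 1))) • ZZ c)) p := by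
  have h1 : HasFDerivAt (fun p : Spacetime n => b * ZZ c p ^ l)
      ((b * (l * ZZ c p ^ (l - 1))) • ZZ c) p := by
    have := (((ZZ c).hasFDerivAt (x := p)).pow l).const_mul b
    refine this.congr_fderiv ?_
    ext v <;> simp [mul_assoc]
  exact Complex.reCLM.hasFDerivAt.comp p h1

lemma fd_Y (c : Fin n → ℂ) (b : ℂ) (l : ℕ) (p v : Spacetime n) :
    fderiv ℝ (fun p : Spacetime n => (b * ZZ c p ^ l).re) p v =
      (b * (l * ZZ c p ^ (l - 1)) * ZZ c v).re := by
  rw [(hasF_Y c b l p).fderiv]; simp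

def Y (c : Fin n → ℂ) (l : ℕ) (p : Spacetime n) : ℝ := (1 * ZZ c p ^ l).re
def G (g : ℝ → ℝ) (p : Spacetime n) : ℝ := g (‖p.2‖ ^ 2)

lemma diff_Y (c : Fin n → ℂ) (b : ℂ) (l : ℕ) :
    Differentiable ℝ (fun p : Spacetime n => (b * ZZ c p ^ l).re) :=
  fun p => (hasF_Y c b l p).differentiableAt

lemma diff_G {g : ℝ → ℝ} (hg : Differentiable ℝ g) : Differentiable ℝ (G (n := n) g) :=
  fun _ => (hasF_G (hg _)).differentiableAt

lemma dt_zero {g : ℝ → ℝ} (hg : Differentiable ℝ g) (c : Fin n → ℂ) (l : ℕ) :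
    dt (fun p : Spacetime n => G g p * Y c l p) = fun _ => 0 := by
  funext p
  unfold dt
  rw [fderiv_fun_mul (diff_G hg p) (show DifferentiableAt ℝ (Y c l) p from diff_Y c 1 l p)]
  have h1 := fd_G (p := p) hg ((1, 0) : Spacetime n)
  have h2 := fd_Y c 1 l p ((1, 0) : Spacetime n)
  have h3 : ZZ c ((1, 0) : Spacetime n) = 0 := by simp [ZZ_apply]
  rw [h3] at h2
  change _ * (fderiv ℝ (fun p : Spacetime n => (1 * ZZ c p ^ l).re) p) _ + _ *
    (fderiv ℝ (fun p : Spacetime n => g (‖p.2‖ ^ 2)) p) _ = _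
  rw [h1, h2]; simp

lemma inner_single' (x : EuclideanSpace ℝ (Fin n)) (i : Fin n) :
    ⟪x, EuclideanSpace.single i (1 : ℝ)⟫_ℝ = x i := by
  simp [EuclideanSpace.inner_single_right]

lemma dx_one {g : ℝ → ℝ} (hg : Differentiable ℝ g) (c : Fin n → ℂ) (l : ℕ) (i : Fin n) :
    dx i (fun p : Spacetime n => G g p * Y c l p) = fun p =>
      G g p * (c i * l * ZZ c p ^ (l - 1)).re + (2 * p.2 i) * G (deriv g) p * Y c l p := by
  funext p
  unfold dx
  rw [fderiv_fun_mul (diff_G hg p) (show DifferentiableAt ℝ (Y c l) p from diff_Y c 1 l p)]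
  have h1 := fd_G (p := p) hg ((0, EuclideanSpace.single i 1) : Spacetime n)
  have h2 := fd_Y c 1 l p ((0, EuclideanSpace.single i 1) : Spacetime n)
  rw [ZZ_single] at h2
  change _ * (fderiv ℝ (fun p : Spacetime n => (1 * ZZ c p ^ l).re) p) _ + _ *
    (fderiv ℝ (fun p : Spacetime n => g (‖p.2‖ ^ 2)) p) _ = _
  rw [h1, h2, inner_single']
  simp only [G]
  rw [show (1 * (l * ZZ c p ^ (l - 1)) * c i : ℂ) = c i * l * ZZ c p ^ (l - 1) by ring]
  ring

lemma dx_two {g : ℝ → ℝ} (hg : Differentiable ℝ g) (hg' : Differentiable ℝ (deriv g))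
    (c : Fin n → ℂ) (l : ℕ) (i : Fin n) (p : Spacetime n) :
    dx i (dx i (fun p : Spacetime n => G g p * Y c l p)) p =
      G g p * (c i ^ 2 * (l * (l - 1 : ℕ) * ZZ c p ^ (l - 1 - 1))).re
      + 4 * G (deriv g) p * ((c i * p.2 i) * (l * ZZ c p ^ (l - 1))).re
      + 2 * G (deriv g) p * Y c l p + 4 * (p.2 i) ^ 2 * G (deriv (deriv g)) p * Y c l p := by
  rw [dx_one hg]
  set v : Spacetime n := (0, EuclideanSpace.single i 1) with hv
  have hx : HasFDerivAt (fun p : Spacetime n => 2 * p.2 i)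
      ((2 : ℝ) • (EuclideanSpace.proj i).comp
        (ContinuousLinearMap.snd ℝ ℝ (EuclideanSpace ℝ (Fin n)))) p :=
    (((EuclideanSpace.proj i).comp
        (ContinuousLinearMap.snd ℝ ℝ (EuclideanSpace ℝ (Fin n)))).hasFDerivAt).const_mul 2
  have hG : HasFDerivAt (G (n := n) g) _ p := hasF_G (hg _)
  have hG' : HasFDerivAt (G (n := n) (deriv g)) _ p := hasF_G (hg' _)
  have hY : HasFDerivAt (Y c l) _ p := hasF_Y c 1 l p
  have hY' := hasF_Y c (c i * l) (l - 1) p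
  have := (hG.mul hY').add ((hx.mul hG').mul hY)
  unfold dx
  have e := this.fderiv
  simp only [Pi.mul_def, Pi.add_def] at e
  rw [e, ← hv]
  have h3 : ZZ c v = c i := ZZ_single c i 0
  have h4 : ⟪p.2, v.2⟫_ℝ = p.2 i := inner_single' _ _
  have h5 : (EuclideanSpace.proj i : EuclideanSpace ℝ (Fin n) →L[ℝ] ℝ) v.2 = 1 := by simp [hv]
  simp only [add_apply, smul_apply,
    ContinuousLinearMap.comp_apply, h3, ContinuousLinearMap.coe_snd', innerSL_apply_apply, h4,
    smul_eq_mul, Complex.reCLM_apply, h5]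
  rw [show (c i * l * (((l - 1 : ℕ) : ℂ) * ZZ c p ^ (l - 1 - 1)) * c i : ℂ) =
      c i ^ 2 * (l * (l - 1 : ℕ) * ZZ c p ^ (l - 1 - 1)) by ring,
    show ((c i * p.2 i) * (l * ZZ c p ^ (l - 1)) : ℂ) =
      (p.2 i : ℂ) * (c i * l * ZZ c p ^ (l - 1)) by ring,
    show (1 * (l * ZZ c p ^ (l - 1)) * c i : ℂ) = c i * l * ZZ c p ^ (l - 1) by ring,
    Complex.re_ofReal_mul]
  simp only [G]
  ring

lemma box_eq {g : ℝ → ℝ} (hg : Differentiable ℝ g) (hg' : Differentiable ℝ (deriv g))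
    (c : Fin n → ℂ) (hc : ∑ i, c i ^ 2 = 0) (l : ℕ) (hl : l ≠ 0) (p : Spacetime n) :
    box (fun p : Spacetime n => G g p * Y c l p) p =
      (4 * ‖p.2‖ ^ 2 * G (deriv (deriv g)) p + (2 * n + 4 * l) * G (deriv g) p) * Y c l p := by
  unfold box
  rw [dt_zero hg]
  have h0 : dt (fun _ : Spacetime n => (0 : ℝ)) p = 0 := by simp [dt]
  rw [h0]
  simp_rw [dx_two hg hg']
  rw [Finset.sum_add_distrib, Finset.sum_add_distrib, Finset.sum_add_distrib,
    ← Finset.mul_sum, ← Finset.mul_sum, ← Complex.re_sum, ← Complex.re_sum, ← Finset.sum_mul,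
    ← Finset.sum_mul, hc, ← ZZ_apply, ← Finset.sum_mul, ← Finset.sum_mul, ← Finset.sum_mul,
    ← Finset.sum_mul, ← Finset.mul_sum]
  have h1 : ‖p.2‖ ^ 2 = ∑ i, p.2 i ^ 2 := by
    simp [EuclideanSpace.norm_sq_eq]
  have h2 : (ZZ c p * (l * ZZ c p ^ (l - 1))).re = l * Y c l p := by
    rw [show ZZ c p * (l * ZZ c p ^ (l - 1)) = (l : ℂ) * (ZZ c p ^ (l - 1) * ZZ c p) by ring,
      pow_sub_one_mul hl, Y, one_mul]
    rw [← Complex.ofReal_natCast, Complex.re_ofReal_mul]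
  rw [h2, ← h1]
  simp
  ring

lemma norm_ZZ_le (c : Fin n → ℂ) (hc : ∀ i, ‖c i‖ ≤ 1) (p : Spacetime n) :
    ‖ZZ c p‖ ≤ n * ‖p.2‖ := by
  rw [ZZ_apply]
  refine (norm_sum_le _ _).trans ?_
  refine (Finset.sum_le_card_nsmul _ _ ‖p.2‖ ?_).trans (by simp)
  intro i _
  rw [norm_mul, Complex.norm_real]
  calc _ ≤ 1 * ‖p.2‖ := mul_le_mul (hc i) (PiLp.norm_apply_le _ _) (norm_nonneg _) zero_le_one
    _ = _ := one_mul _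

lemma Y_le (c : Fin n → ℂ) (hc : ∀ i, ‖c i‖ ≤ 1) (l : ℕ) (p : Spacetime n) :
    |Y c l p| ≤ (n : ℝ) ^ l * ‖p.2‖ ^ l := by
  unfold Y
  refine (Complex.abs_re_le_norm _).trans ?_
  rw [one_mul, norm_pow, ← mul_pow]
  exact pow_le_pow_left₀ (norm_nonneg _) (norm_ZZ_le c hc p) l

lemma contDiff_G {g : ℝ → ℝ} (hg : ContDiff ℝ ∞ g) : ContDiff ℝ ∞ (G (n := n) g) :=
  hg.comp (contDiff_snd.norm_sq ℝ)

lemma contDiff_Y (c : Fin n → ℂ) (l : ℕ) : ContDiff ℝ ∞ (Y c l) :=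
  Complex.reCLM.contDiff.comp (contDiff_const.mul ((ZZ c).contDiff.pow l))

lemma decay (hn : 2 ≤ n) (k : ℝ) (hk : 0 < k) (c : Fin n → ℂ) (hc : ∀ i, ‖c i‖ ≤ 1) (l : ℕ)
    (hl : k ≤ l) : ∃ C : ℝ, 0 < C ∧ ∀ p : Spacetime n,
      |G (gg (((n : ℝ) - 2) / 2 + l)) p * Y c l p| ≤ C * (1 + ‖p.2‖) ^ (-k) := by
  set a : ℝ := ((n : ℝ) - 2) / 2 + l with ha
  have hn' : (2 : ℝ) ≤ n := by exact_mod_cast hn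
  obtain ⟨M, hM⟩ := (isCompact_Icc (a := (0 : ℝ)) (b := 1)).bddAbove_image
    (gg_smooth a).continuous.continuousOn
  have hM' : ∀ s, 0 ≤ s → s ≤ 1 → gg a s ≤ M := fun s h0 h1 => hM ⟨s, ⟨h0, h1⟩, rfl⟩
  have hMpos : 0 < M := (gg_pos a 0).trans_le (hM' 0 le_rfl zero_le_one)
  have hnl : (0 : ℝ) < (n : ℝ) ^ l := by positivity
  refine ⟨(M + 1) * n ^ l * 2 ^ k, by positivity, fun p => ?_⟩
  set r := ‖p.2‖ with hr
  have hr0 : 0 ≤ r := norm_nonneg _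
  have hG0 : 0 < G (gg a) p := gg_pos _ _
  rw [abs_mul, abs_of_pos hG0]
  have hY := Y_le c hc l p
  rw [← hr] at hY
  rcases le_or_gt r 1 with h | h
  · have h1 : G (gg a) p ≤ M := hM' _ (by positivity) (by rw [← hr]; exact pow_le_one₀ hr0 h)
    have h2 : |Y c l p| ≤ (n : ℝ) ^ l :=
      hY.trans (mul_le_of_le_one_right hnl.le (pow_le_one₀ hr0 h))
    have h3 : 1 ≤ (2 : ℝ) ^ k * (1 + r) ^ (-k) := by
      rw [Real.rpow_neg (by positivity), ← div_eq_mul_inv, one_le_div (by positivity)]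
      exact Real.rpow_le_rpow (by positivity) (by linarith) hk.le
    calc _ ≤ M * (n : ℝ) ^ l := mul_le_mul h1 h2 (abs_nonneg _) hMpos.le
      _ ≤ ((M + 1) * n ^ l) * 1 := by nlinarith
      _ ≤ ((M + 1) * n ^ l) * ((2 : ℝ) ^ k * (1 + r) ^ (-k)) := by gcongr
      _ = _ := by ring
  · have hrp : 0 < r := by linarith
    have h1 : G (gg a) p = r ^ (-(2 * a)) := by
      rw [G, gg, ← hr, mm_eq (by nlinarith), ← Real.rpow_natCast, ← Real.rpow_mul hr0]
      congr 1; push_cast; ring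
    have h3 : r ^ (-k) ≤ (2 : ℝ) ^ k * (1 + r) ^ (-k) := by
      rw [Real.rpow_neg (by positivity), Real.rpow_neg (by positivity), ← div_eq_mul_inv,
        inv_eq_one_div, div_le_div_iff₀ (by positivity) (by positivity), one_mul,
        ← Real.mul_rpow (by positivity) (by positivity)]
      exact Real.rpow_le_rpow (by positivity) (by linarith) hk.le
    calc _ ≤ r ^ (-(2 * a)) * ((n : ℝ) ^ l * r ^ l) := by rw [h1]; gcongr
      _ = (n : ℝ) ^ l * r ^ (-(2 * a) + l) := by
        rw [Real.rpow_add hrp, Real.rpow_natCast]; ring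
      _ ≤ (n : ℝ) ^ l * r ^ (-k) := by
        gcongr
        · exact h.le
        · rw [ha]; linarith
      _ ≤ ((M + 1) * n ^ l) * r ^ (-k) := by
        gcongr; nlinarith
      _ ≤ ((M + 1) * n ^ l) * ((2 : ℝ) ^ k * (1 + r) ^ (-k)) := by gcongr
      _ = _ := by ring

lemma exists_c (hn : 2 ≤ n) : ∃ (c : Fin n → ℂ) (i : Fin n), c i = 1 ∧ (∀ i, ‖c i‖ ≤ 1) ∧
    ∑ i, c i ^ 2 = 0 := by
  obtain ⟨m, rfl⟩ := Nat.exists_eq_add_of_le' hn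
  refine ⟨Fin.cons 1 (Fin.cons Complex.I fun _ => 0), 0, rfl, ?_, ?_⟩
  · intro i
    refine Fin.cases ?_ (fun i => ?_) i
    · simp
    · refine Fin.cases ?_ (fun i => ?_) i <;> simp
  · simp [Fin.sum_univ_succ]

end UCaux

/-- **Proposition 1.2** (optimality): for every `n ≥ 2` and `k > 0` there are a compactly
(spatially) supported smooth potential `𝒱`, a smooth global solution `φ` of `□φ + 𝒱φ = 0`
decaying like `(1+|x|)^{−k}`, with `φ` not identically zero on the exterior region `D`. -/
theorem uc_optimal (n : ℕ) (hn : 2 ≤ n) (k : ℝ) (hk : 0 < k) :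
    ∃ (R : ℝ) (𝒱 φ : Spacetime n → ℝ) (C : ℝ),
      0 < R ∧ 0 < C ∧
      ContDiff ℝ (⊤ : ℕ∞) 𝒱 ∧ ContDiff ℝ (⊤ : ℕ∞) φ ∧
      (∀ p : Spacetime n, R < ‖p.2‖ → 𝒱 p = 0) ∧
      (∀ p : Spacetime n, box φ p + 𝒱 p * φ p = 0) ∧
      (∀ p : Spacetime n, |φ p| ≤ C * (1 + ‖p.2‖) ^ (-k)) ∧
      (∃ q ∈ Dom n, φ q ≠ 0) := by
  classical
  obtain ⟨c, i₀, hi, hc1, hc2⟩ := UCaux.exists_c hn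
  obtain ⟨l, hl⟩ := exists_nat_ge k
  have hl0 : l ≠ 0 := by
    rintro rfl
    simp at hl
    linarith
  obtain ⟨C, hC, hdec⟩ := UCaux.decay hn k hk c hc1 l hl
  set a : ℝ := ((n : ℝ) - 2) / 2 + l with ha
  have s0 := UCaux.gg_smooth a
  have s1 := UCaux.gg_deriv_smooth a
  have s2 := UCaux.gg_deriv2_smooth a
  have hpos : ∀ p : Spacetime n, UCaux.G (UCaux.gg a) p ≠ 0 := fun p => (UCaux.gg_pos _ _).ne'
  refine ⟨1, fun p => -((4 * ‖p.2‖ ^ 2 * UCaux.G (deriv (deriv (UCaux.gg a))) p +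
      (2 * n + 4 * l) * UCaux.G (deriv (UCaux.gg a)) p) / UCaux.G (UCaux.gg a) p),
    fun p => UCaux.G (UCaux.gg a) p * UCaux.Y c l p, C, one_pos, hC, ?_, ?_, ?_, ?_, hdec, ?_⟩
  · exact (((((contDiff_const.mul (contDiff_snd.norm_sq ℝ)).mul (UCaux.contDiff_G s2))).add
      (contDiff_const.mul (UCaux.contDiff_G s1))).div (UCaux.contDiff_G s0) hpos).neg
  · exact (UCaux.contDiff_G s0).mul (UCaux.contDiff_Y c l)
  · intro p hp
    have hs : 1 < ‖p.2‖ ^ 2 := by nlinarith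
    have hs0 : 0 < ‖p.2‖ ^ 2 := by linarith
    simp only [UCaux.G]
    rw [UCaux.gg_deriv hs, UCaux.gg_deriv2 hs]
    rw [show 4 * ‖p.2‖ ^ 2 * (-a * ((-a - 1) * (‖p.2‖ ^ 2) ^ (-a - 1 - 1))) =
      -4 * a * (-a - 1) * (‖p.2‖ ^ 2) ^ (-a - 1) by
        rw [Real.rpow_sub_one hs0.ne' (-a - 1)]; field_simp]
    have : (-4 * a * (-a - 1) * (‖p.2‖ ^ 2) ^ (-a - 1) +
        (2 * n + 4 * l) * (-a * (‖p.2‖ ^ 2) ^ (-a - 1))) = 0 := by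
      rw [ha]; ring
    rw [this]; simp
  · intro p
    rw [UCaux.box_eq (s0.differentiable (by simp)) (s1.differentiable (by simp)) c hc2 l hl0 p]
    have := hpos p
    field_simp
    ring
  · refine ⟨(0, EuclideanSpace.single i₀ 1), by simp [Dom], ?_⟩
    refine mul_ne_zero (hpos _) ?_
    rw [UCaux.Y, UCaux.ZZ_single, hi]
    simp
end
end
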